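/- arXiv:2605.06824 — 7 statements merged into one kernel-verified Lean document; each statement's English description precedes it below -/
import Mathlib

section
/- Let Γ be a plumbing tree with framing matrix B, let v_i and v_j be adjacent vertices of Γ with weights m_1 and m_2, and let Γ∘ be the plumbing tree obtained from Γ by the move (A−): the edge between v_i and v_j is subdivided by a new vertex w of weight −1, and the weights of v_i and v_j are changed to m_1 − 1 and m_2 − 1 respectively (all other vertices, weights, and edges unchanged). If B∘ denotes the framing matrix of Γ∘, then n_+(B∘) = n_+(B) and n_-(B∘) = n_-(B) + 1. -/
/-- A plumbing tree: a finite tree with integer vertex weights (Euler numbers). -/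
structure PlumbingTree (V : Type) [Fintype V] where
  adj : SimpleGraph V
  isTree : adj.IsTree
  weight : V → ℤ

open Classical in
/-- The framing matrix of a plumbing tree, viewed as a real symmetric matrix. -/
noncomputable def framing {V : Type} [Fintype V] (Γ : PlumbingTree V) :
    Matrix V V ℝ :=
  Matrix.of fun i j =>
    if i = j then (Γ.weight i : ℝ) else if Γ.adj.Adj i j then 1 else 0

/-- The number of positive eigenvalues (with multiplicity) of a symmetric real matrix. -/
noncomputable def nPos {V : Type} [Fintype V] [DecidableEq V] (A : Matrix V V ℝ) : ℕ :=
  if h : A.IsHermitian then Nat.card {i // 0 < h.eigenvalues i} else 0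

/-- The number of negative eigenvalues (with multiplicity) of a symmetric real matrix. -/
noncomputable def nNeg {V : Type} [Fintype V] [DecidableEq V] (A : Matrix V V ℝ) : ℕ :=
  if h : A.IsHermitian then Nat.card {i // h.eigenvalues i < 0} else 0

section

open Matrix QuadraticMap

/-- A real symmetric matrix defines a quadratic form equivalent to the sum of squares weighted by
its eigenvalues. -/
lemma Matrix.IsHermitian.toQuadraticForm'_equivalent_weightedSumSquares
    {n : Type*} [Fintype n] [DecidableEq n] {A : Matrix n n ℝ} (hA : A.IsHermitian) :
    A.toQuadraticForm'.Equivalent (weightedSumSquares ℝ hA.eigenvalues) := by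
  let U : Matrix n n ℝ := hA.eigenvectorUnitary
  have hUU : star U * U = 1 := Unitary.coe_star_mul_self _
  have hUU' : U * star U = 1 := Unitary.coe_mul_star_self _
  have hAU : A = U * diagonal hA.eigenvalues * star U := by
    simpa [Unitary.conjStarAlgAut_apply] using hA.spectral_theorem
  refine ⟨⟨toLin'OfInv hUU' hUU, fun x => ?_⟩⟩
  have hx : A.toQuadraticForm' x = x ⬝ᵥ (A *ᵥ x) := by
    simp [toQuadraticForm', toLinearMap₂'_apply']
  have hy : weightedSumSquares ℝ hA.eigenvalues (star U *ᵥ x) =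
      (star U *ᵥ x) ⬝ᵥ (diagonal hA.eigenvalues *ᵥ (star U *ᵥ x)) := by
    simp only [weightedSumSquares_apply, dotProduct, mulVec_diagonal, smul_eq_mul]
    exact Finset.sum_congr rfl fun i _ => by ring
  rw [hx]
  change weightedSumSquares ℝ hA.eigenvalues (toLin' (star U) x) = _
  rw [toLin'_apply, hy]
  rw [star_eq_conjTranspose, conjTranspose_eq_transpose_of_trivial] at *
  conv_rhs => rw [hAU]
  rw [← mulVec_mulVec, ← mulVec_mulVec, dotProduct_mulVec x U, ← mulVec_transpose]

lemma nPos_eq_ncard_of_equivalent {n ι : Type} [Fintype n] [DecidableEq n] [Fintype ι]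
    {A : Matrix n n ℝ} (hA : A.IsHermitian) {d : ι → ℝ}
    (h : A.toQuadraticForm'.Equivalent (weightedSumSquares ℝ d)) :
    nPos A = {i | 0 < d i}.ncard := by
  rw [← QuadraticForm.sigPos_of_equiv_weightedSumSquares h,
    QuadraticForm.sigPos_of_equiv_weightedSumSquares
      hA.toQuadraticForm'_equivalent_weightedSumSquares, nPos, dif_pos hA]
  rfl

lemma nNeg_eq_ncard_of_equivalent {n ι : Type} [Fintype n] [DecidableEq n] [Fintype ι]
    {A : Matrix n n ℝ} (hA : A.IsHermitian) {d : ι → ℝ}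
    (h : A.toQuadraticForm'.Equivalent (weightedSumSquares ℝ d)) :
    nNeg A = {i | d i < 0}.ncard := by
  rw [← QuadraticForm.sigNeg_of_equiv_weightedSumSquares h,
    QuadraticForm.sigNeg_of_equiv_weightedSumSquares
      hA.toQuadraticForm'_equivalent_weightedSumSquares, nNeg, dif_pos hA]
  rfl

lemma framing_isHermitian {V : Type} [Fintype V] (Γ : PlumbingTree V) :
    (framing Γ).IsHermitian := by
  classical
  ext i j
  by_cases h : i = j
  · simp [h]
  · simpa [framing, h, Ne.symm h] using if_congr (Γ.adj.adj_comm j i) rfl rfl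

/-- Completing the square in the coordinate `none`. -/
lemma toQuadraticForm'_apply_of_blowup {V W : Type*} [Fintype V] [DecidableEq V] [Fintype W]
    [DecidableEq W] {A : Matrix V V ℝ} {A' : Matrix W W ℝ} (g : Option V ≃ W) (u : V → ℝ)
    (h₀ : A' (g none) (g none) = -1)
    (h₁ : ∀ a, A' (g none) (g (some a)) = u a) (h₂ : ∀ a, A' (g (some a)) (g none) = u a)
    (h₃ : ∀ a b, A' (g (some a)) (g (some b)) = A a b - u a * u b) (x : W → ℝ) :
    A'.toQuadraticForm' x = A.toQuadraticForm' (fun a => x (g (some a))) -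
      (x (g none) - ∑ a, u a * x (g (some a))) ^ 2 := by
  simp only [toQuadraticForm', LinearMap.BilinMap.toQuadraticMap_apply, toLinearMap₂'_apply,
    smul_eq_mul]
  simp only [← g.sum_comp, Fintype.sum_option, h₀, h₁, h₂, h₃, Finset.sum_add_distrib]
  have hs : ∑ a, ∑ b, x (g (some a)) * (x (g (some b)) * (A a b - u a * u b)) =
      ∑ a, ∑ b, x (g (some a)) * (x (g (some b)) * A a b) -
        (∑ a, u a * x (g (some a))) ^ 2 := by
    rw [pow_two, Finset.sum_mul_sum, ← Finset.sum_sub_distrib]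
    refine Finset.sum_congr rfl fun a _ => ?_
    rw [← Finset.sum_sub_distrib]
    exact Finset.sum_congr rfl fun b _ => by ring
  have hl : ∑ a, x (g none) * (x (g (some a)) * u a) =
      x (g none) * ∑ a, u a * x (g (some a)) := by
    rw [Finset.mul_sum]
    exact Finset.sum_congr rfl fun a _ => by ring
  have hr : ∑ a, x (g (some a)) * (x (g none) * u a) =
      x (g none) * ∑ a, u a * x (g (some a)) := by
    rw [Finset.mul_sum]
    exact Finset.sum_congr rfl fun a _ => by ring
  rw [hs, hl, hr]
  ring

lemma toQuadraticForm'_equivalent_of_blowup {V W : Type*} [Fintype V] [DecidableEq V] [Fintype W]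
    [DecidableEq W] {A : Matrix V V ℝ} {A' : Matrix W W ℝ} (g : Option V ≃ W) (u : V → ℝ)
    (h₀ : A' (g none) (g none) = -1)
    (h₁ : ∀ a, A' (g none) (g (some a)) = u a) (h₂ : ∀ a, A' (g (some a)) (g none) = u a)
    (h₃ : ∀ a b, A' (g (some a)) (g (some b)) = A a b - u a * u b) {d : V → ℝ}
    (hd : A.toQuadraticForm'.Equivalent (weightedSumSquares ℝ d)) :
    A'.toQuadraticForm'.Equivalent
      (weightedSumSquares ℝ fun o : Option V => o.elim (-1) d) := by
  obtain ⟨e⟩ := hd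
  let φ : (W → ℝ) →ₗ[ℝ] (Option V → ℝ) := LinearMap.pi fun o =>
    o.elim (LinearMap.proj (g none) - ∑ a, u a • LinearMap.proj (g (some a)))
      fun v => LinearMap.proj v ∘ₗ e.toLinearEquiv.toLinearMap ∘ₗ
        LinearMap.funLeft ℝ ℝ fun a => g (some a)
  have hnone (x) : φ x none = x (g none) - ∑ a, u a * x (g (some a)) := by
    simp [φ]
  have hsome (x) (v : V) : φ x (some v) = e (fun a => x (g (some a))) v := rfl
  have hφ : Function.Injective φ := by
    rw [← LinearMap.ker_eq_bot, LinearMap.ker_eq_bot']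
    intro x hx
    have hV : (fun a => x (g (some a))) = 0 := by
      refine e.toLinearEquiv.map_eq_zero_iff.1 (funext fun v => ?_)
      exact (hsome x v).symm.trans (congrFun hx (some v))
    have hw := (hnone x).symm.trans (congrFun hx none)
    simp only [fun a => congrFun hV a, Pi.zero_apply, mul_zero, Finset.sum_const_zero,
      sub_zero] at hw
    refine funext fun y => ?_
    obtain ⟨_ | v, rfl⟩ := g.surjective y
    · exact hw
    · exact congrFun hV v
  have hdim : Module.finrank ℝ (W → ℝ) = Module.finrank ℝ (Option V → ℝ) := by
    rw [Module.finrank_fintype_fun_eq_card, Module.finrank_fintype_fun_eq_card,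
      Fintype.card_congr g]
  refine ⟨⟨LinearEquiv.ofInjectiveOfFinrankEq φ hφ hdim, fun x => ?_⟩⟩
  change weightedSumSquares ℝ _ (φ x) = _
  rw [toQuadraticForm'_apply_of_blowup g u h₀ h₁ h₂ h₃, ← e.map_app]
  simp only [weightedSumSquares_apply, Fintype.sum_option, hnone, hsome, Option.elim, smul_eq_mul]
  ring

end

/-- **Neumann move (A−) and the signature.**
If `Γ'` is obtained from the plumbing tree `Γ` by the move (A−) — the edge
between adjacent vertices `vi`, `vj` is subdivided by a new vertex `w` of
weight `-1`, and the weights of `vi`, `vj` each drop by `1`, everything else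
unchanged — then `n₊(B∘) = n₊(B)` and `n₋(B∘) = n₋(B) + 1` for the framing
matrices. -/
theorem neumann_move_A_neg_signature
    {V W : Type} [Fintype V] [DecidableEq V] [Fintype W] [DecidableEq W]
    (Γ : PlumbingTree V) (Γ' : PlumbingTree W)
    (vi vj : V) (hadj : Γ.adj.Adj vi vj)
    (f : V → W) (w : W)
    (hf : Function.Injective f)
    (hw : ∀ v, f v ≠ w)
    (hsurj : ∀ x : W, x = w ∨ ∃ v, f v = x)
    (hwi : Γ'.weight (f vi) = Γ.weight vi - 1)
    (hwj : Γ'.weight (f vj) = Γ.weight vj - 1)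
    (hwother : ∀ v, v ≠ vi → v ≠ vj → Γ'.weight (f v) = Γ.weight v)
    (hww : Γ'.weight w = -1)
    (hadjw : ∀ v, Γ'.adj.Adj w (f v) ↔ (v = vi ∨ v = vj))
    (hadjf : ∀ a b, Γ'.adj.Adj (f a) (f b) ↔
      (Γ.adj.Adj a b ∧ ¬(a = vi ∧ b = vj) ∧ ¬(a = vj ∧ b = vi))) :
    nPos (framing Γ') = nPos (framing Γ) ∧
    nNeg (framing Γ') = nNeg (framing Γ) + 1 := by
  classical
  let g : Option V ≃ W := Equiv.ofBijective (fun o => o.elim w f) (by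
    refine ⟨?_, fun x => ?_⟩
    · rintro (_ | a) (_ | b) h
      · rfl
      · exact absurd h.symm (hw b)
      · exact absurd h (hw a)
      · exact congrArg some (hf h)
    · obtain rfl | ⟨v, rfl⟩ := hsurj x
      · exact ⟨none, rfl⟩
      · exact ⟨some v, rfl⟩)
  let u : V → ℝ := fun a => if a = vi ∨ a = vj then 1 else 0
  have h₁ (a) : framing Γ' w (f a) = u a := by
    simp [framing, (hw a).symm, hadjw, u]
  have h₃ (a b) : framing Γ' (f a) (f b) = framing Γ a b - u a * u b := by
    have hadj' := hadj.symm
    by_cases hab : a = b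
    · subst hab
      by_cases hi : a = vi
      · subst hi
        simp [framing, u, hwi]
      · by_cases hj : a = vj
        · subst hj
          simp [framing, u, hwj]
        · simp [framing, u, hi, hj, hwother a hi hj]
    · simp only [framing, Matrix.of_apply, hf.eq_iff, hab, if_false, hadjf, u]
      grind
  have hB := (framing_isHermitian Γ).toQuadraticForm'_equivalent_weightedSumSquares
  have hB' := toQuadraticForm'_equivalent_of_blowup (A' := framing Γ') g u
    (show framing Γ' w w = -1 by simp [framing, hww]) h₁
    (fun a => ((framing_isHermitian Γ').apply _ _).symm.trans (h₁ a)) h₃ hB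
  rw [nPos_eq_ncard_of_equivalent (framing_isHermitian Γ') hB',
    nPos_eq_ncard_of_equivalent (framing_isHermitian Γ) hB,
    nNeg_eq_ncard_of_equivalent (framing_isHermitian Γ') hB',
    nNeg_eq_ncard_of_equivalent (framing_isHermitian Γ) hB]
  constructor
  · rw [← Set.ncard_image_of_injective _ (Option.some_injective V)]
    congr 1
    ext (_ | v) <;> simp
  · rw [← Set.ncard_image_of_injective _ (Option.some_injective V),
      ← Set.ncard_insert_of_notMem (a := none) (by simp)]
    congr 1
    ext (_ | v) <;> simp
end

section
/- Let B be a symmetric s×s rational matrix, let j be an index, and let S be a nonempty set of indices not containing j such that for every i ∈ S: B_{ii} = e_i ≠ 0, B_{ij} = B_{ji} = 1, and B_{ik} = 0 for all k ∉ {i, j}. Let B' be the matrix obtained from B by setting B'_{ij} = B'_{ji} = 0 for all i ∈ S and replacing the (j,j) entry by B_{jj} − Σ_{i ∈ S} 1/e_i, all other entries unchanged. Then B' is congruent to B (B' = L B Lᵀ for some invertible rational matrix L); in particular n_+(B') = n_+(B) and n_-(B') = n_-(B). -/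
open Matrix

/-- The number of positive eigenvalues (with multiplicity) of a symmetric
rational matrix, computed via the associated real symmetric matrix. -/
noncomputable def nPosQ {V : Type} [Fintype V] [DecidableEq V] (A : Matrix V V ℚ) : ℕ :=
  if h : (A.map ((↑) : ℚ → ℝ)).IsHermitian then Nat.card {i // 0 < h.eigenvalues i} else 0

/-- The number of negative eigenvalues (with multiplicity) of a symmetric
rational matrix, computed via the associated real symmetric matrix. -/
noncomputable def nNegQ {V : Type} [Fintype V] [DecidableEq V] (A : Matrix V V ℚ) : ℕ :=
  if h : (A.map ((↑) : ℚ → ℝ)).IsHermitian then Nat.card {i // h.eigenvalues i < 0} else 0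

namespace Matrix

section QuadraticForm

variable {n R : Type*} [Fintype n] [DecidableEq n] [CommRing R]

theorem toQuadraticForm'_apply (M : Matrix n n R) (x : n → R) :
    M.toQuadraticForm' x = x ⬝ᵥ M *ᵥ x := by
  simp [toQuadraticForm', toLinearMap₂'_apply']

/-- Congruent matrices define equivalent quadratic forms. -/
theorem equivalent_toQuadraticForm'_of_congruent (M L : Matrix n n R) (hL : IsUnit L.det) :
    (L * M * Lᵀ).toQuadraticForm'.Equivalent M.toQuadraticForm' := by
  refine ⟨{ toLinearEquiv' Lᵀ (invertibleOfIsUnitDet Lᵀ (by rwa [det_transpose])) with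
    map_app' := fun x => ?_ }⟩
  change M.toQuadraticForm' (Lᵀ *ᵥ x) = _
  simp only [toQuadraticForm'_apply, ← mulVec_mulVec, dotProduct_mulVec x L,
    mulVec_transpose]

theorem toQuadraticForm'_diagonal (w : n → R) :
    (diagonal w).toQuadraticForm' = QuadraticMap.weightedSumSquares R w := by
  ext x
  simp only [toQuadraticForm'_apply, QuadraticMap.weightedSumSquares_apply, dotProduct,
    mulVec_diagonal, smul_eq_mul]
  exact Finset.sum_congr rfl fun i _ => by ring

/-- A rank-one modification of the identity acts by congruence as a symmetric rank-two update. -/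
theorem one_add_vecMulVec_congruence (B : Matrix n n R) (hB : B.IsSymm) (u v : n → R) :
    (1 + vecMulVec u v) * B * (1 + vecMulVec u v)ᵀ =
      B + vecMulVec u (B *ᵥ v) + vecMulVec (B *ᵥ v) u + (v ⬝ᵥ B *ᵥ v) • vecMulVec u u := by
  have hv : v ᵥ* B = B *ᵥ v := by rw [← mulVec_transpose, hB.eq]
  simp only [transpose_add, transpose_one, transpose_vecMulVec, Matrix.add_mul, Matrix.mul_add,
    Matrix.one_mul, Matrix.mul_one, vecMulVec_mul, mul_vecMulVec, hv, add_mulVec, add_vecMulVec, vecMulVec_mulVec,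
    dotProduct_comm (B *ᵥ v) v, op_smul_eq_smul, smul_vecMulVec]
  abel

end QuadraticForm

namespace IsHermitian

variable {n : Type*} [Fintype n] [DecidableEq n] {A : Matrix n n ℝ} (hA : A.IsHermitian)

/-- The spectral theorem, for the quadratic form of a real symmetric matrix. -/
theorem equivalent_weightedSumSquares_eigenvalues :
    A.toQuadraticForm'.Equivalent (QuadraticMap.weightedSumSquares ℝ hA.eigenvalues) := by
  have h : A = (hA.eigenvectorUnitary : Matrix n n ℝ) * diagonal hA.eigenvalues *
      (hA.eigenvectorUnitary : Matrix n n ℝ)ᵀ := by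
    conv_lhs => rw [hA.spectral_theorem, Unitary.conjStarAlgAut_apply]
    rw [star_eq_conjTranspose, conjTranspose_eq_transpose_of_trivial]
    rfl
  rw [← toQuadraticForm'_diagonal]
  conv_lhs => rw [h]
  exact equivalent_toQuadraticForm'_of_congruent _ _
    (UnitaryGroup.det_isUnit hA.eigenvectorUnitary)

theorem card_pos_eigenvalues :
    Nat.card {i // 0 < hA.eigenvalues i} = sigPos A.toQuadraticForm' :=
  (QuadraticForm.sigPos_of_equiv_weightedSumSquares
    hA.equivalent_weightedSumSquares_eigenvalues).symm

theorem card_neg_eigenvalues :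
    Nat.card {i // hA.eigenvalues i < 0} = sigNeg A.toQuadraticForm' :=
  (QuadraticForm.sigNeg_of_equiv_weightedSumSquares
    hA.equivalent_weightedSumSquares_eigenvalues).symm

end IsHermitian

end Matrix

theorem Matrix.IsSymm.isHermitian_map_ratCast {V : Type*} {A : Matrix V V ℚ} (hA : A.IsSymm) :
    (A.map ((↑) : ℚ → ℝ)).IsHermitian := by
  rw [IsHermitian, conjTranspose_eq_transpose_of_trivial, ← transpose_map, hA.eq]

section Inertia

variable {V : Type} [Fintype V] [DecidableEq V]

theorem nPosQ_eq_sigPos {A : Matrix V V ℚ} (hA : A.IsSymm) :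
    nPosQ A = sigPos (A.map ((↑) : ℚ → ℝ)).toQuadraticForm' := by
  rw [nPosQ, dif_pos hA.isHermitian_map_ratCast, IsHermitian.card_pos_eigenvalues]

theorem nNegQ_eq_sigNeg {A : Matrix V V ℚ} (hA : A.IsSymm) :
    nNegQ A = sigNeg (A.map ((↑) : ℚ → ℝ)).toQuadraticForm' := by
  rw [nNegQ, dif_pos hA.isHermitian_map_ratCast, IsHermitian.card_neg_eigenvalues]

/-- **Sylvester's law of inertia** for symmetric rational matrices. -/
theorem nPosQ_nNegQ_congruent {B L : Matrix V V ℚ} (hB : B.IsSymm) (hL : IsUnit L.det) :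
    nPosQ (L * B * Lᵀ) = nPosQ B ∧ nNegQ (L * B * Lᵀ) = nNegQ B := by
  have hB' : (L * B * Lᵀ).IsSymm := by
    simp [IsSymm, transpose_mul, hB.eq, Matrix.mul_assoc]
  have hmap : (L * B * Lᵀ).map ((↑) : ℚ → ℝ) =
      L.map (↑) * B.map (↑) * (L.map ((↑) : ℚ → ℝ))ᵀ := by
    rw [← transpose_map]
    exact (Matrix.map_mul (f := Rat.castHom ℝ)).trans
      (congrArg (· * _) (Matrix.map_mul (f := Rat.castHom ℝ)))
  have hdet : IsUnit (L.map ((↑) : ℚ → ℝ)).det := by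
    have h := hL.map (Rat.castHom ℝ)
    rwa [RingHom.map_det] at h
  have h := equivalent_toQuadraticForm'_of_congruent (B.map ((↑) : ℚ → ℝ)) _ hdet
  rw [← hmap] at h
  exact ⟨by rw [nPosQ_eq_sigPos hB', nPosQ_eq_sigPos hB, h.sigPos_eq],
    by rw [nNegQ_eq_sigNeg hB', nNegQ_eq_sigNeg hB, h.sigNeg_eq]⟩

end Inertia

/-- **Case 1 of the Duchon–Eisenbud–Neumann diagonalization algorithm.**
Let `B` be a symmetric rational matrix, `j` an index, and `S` a nonempty set of
indices not containing `j` such that each `i ∈ S` is a "leaf of nonzero weight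
`e i` attached to `j`": `B i i = e i ≠ 0`, `B i j = B j i = 1`, and
`B i k = 0` for `k ∉ {i, j}`.  Let `B'` be obtained from `B` by deleting the
entries coupling `S` to `j` and replacing the `(j,j)` entry by
`B j j − ∑ i ∈ S, 1 / e i`, all other entries unchanged.  Then `B'` is
congruent to `B`; in particular `n₊(B') = n₊(B)` and `n₋(B') = n₋(B)`. -/
theorem diagonalization_case_one
    {s : ℕ} (B B' : Matrix (Fin s) (Fin s) ℚ) (hB : B.IsSymm)
    (j : Fin s) (S : Finset (Fin s)) (hS : S.Nonempty) (hjS : j ∉ S)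
    (e : Fin s → ℚ)
    (hleaf : ∀ i ∈ S, B i i = e i ∧ e i ≠ 0 ∧ B i j = 1 ∧ B j i = 1 ∧
      ∀ k, k ≠ i → k ≠ j → B i k = 0)
    (hB'S : ∀ i ∈ S, B' i j = 0 ∧ B' j i = 0)
    (hB'j : B' j j = B j j - ∑ i ∈ S, 1 / e i)
    (hB'other : ∀ a b, ¬((a ∈ S ∧ b = j) ∨ (b ∈ S ∧ a = j) ∨ (a = j ∧ b = j)) →
      B' a b = B a b) :
    (∃ L : Matrix (Fin s) (Fin s) ℚ, IsUnit L.det ∧ B' = L * B * Lᵀ) ∧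
    nPosQ B' = nPosQ B ∧ nNegQ B' = nNegQ B := by
  set v : Fin s → ℚ := fun i => if i ∈ S then -(1 / e i) else 0 with hv
  have hBv (a : Fin s) : (B *ᵥ v) a =
      if a ∈ S then -1 else if a = j then -∑ i ∈ S, 1 / e i else 0 := by
    have hsum : (B *ᵥ v) a = ∑ i ∈ S, B i a * -(1 / e i) := by
      simp [mulVec, dotProduct, hv, hB.apply, Finset.sum_ite_mem]
    rw [hsum]
    split_ifs with haS haj
    · rw [Finset.sum_eq_single_of_mem a haS]
      · obtain ⟨h1, h2, -⟩ := hleaf a haS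
        rw [h1]
        field_simp
      · intro i hi hia
        rw [(hleaf i hi).2.2.2.2 a hia.symm (fun h => hjS (h ▸ haS)), zero_mul]
    · subst haj
      rw [← Finset.sum_neg_distrib]
      exact Finset.sum_congr rfl fun i hi => by rw [(hleaf i hi).2.2.1, one_mul]
    · exact Finset.sum_eq_zero fun i hi => by
        rw [(hleaf i hi).2.2.2.2 a (fun h => haS (h ▸ hi)) haj, zero_mul]
  have hvBv : v ⬝ᵥ B *ᵥ v = ∑ i ∈ S, 1 / e i := by
    simp only [dotProduct, hv, ite_mul, zero_mul, Finset.sum_ite_mem, Finset.univ_inter]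
    exact Finset.sum_congr rfl fun i hi => by rw [hBv, if_pos hi]; ring
  have hL : IsUnit (1 + vecMulVec (Pi.single j 1) v).det := by
    rw [vecMulVec_eq Unit, det_one_add_replicateCol_mul_replicateRow]
    simp [hv, hjS]
  have hcongr : B' = (1 + vecMulVec (Pi.single j 1) v) * B *
      (1 + vecMulVec (Pi.single j 1) v)ᵀ := by
    rw [one_add_vecMulVec_congruence B hB, hvBv]
    ext a b
    simp only [Matrix.add_apply, Matrix.smul_apply, vecMulVec_apply, hBv, Pi.single_apply, smul_eq_mul]
    by_cases haj : a = j <;> by_cases hbj : b = j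
    · subst haj hbj
      simp only [hB'j, hjS, if_true, if_false]
      ring
    · subst haj
      by_cases hbS : b ∈ S
      · simp [(hB'S b hbS).2, (hleaf b hbS).2.2.2.1, hbS, hbj]
      · simp [hB'other a b (by tauto), hbS, hbj]
    · subst hbj
      by_cases haS : a ∈ S
      · simp [(hB'S a haS).1, (hleaf a haS).2.2.1, haS, haj]
      · simp [hB'other a b (by tauto), haS, haj]
    · simp [hB'other a b (by tauto), haj, hbj]
  refine ⟨⟨_, hL, hcongr⟩, ?_⟩
  rw [hcongr]
  exact nPosQ_nNegQ_congruent hB hL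
end

section
/- Let a_0, a_1, …, a_n be rational numbers and let T be the (n+1)×(n+1) symmetric tridiagonal matrix with diagonal entries a_0, …, a_n and all sub- and super-diagonal entries equal to 1 (the framing matrix of a linear plumbing tree). Suppose that for every i with 0 ≤ i ≤ n the negative continued fraction d_i := ⟦a_i, a_{i+1}, …, a_n⟧ is defined and nonzero. Then T is congruent to the diagonal matrix diag(d_0, d_1, …, d_n); in particular n_+(T) equals the number of indices i with d_i > 0 and n_-(T) equals the number of indices i with d_i < 0. -/
open Matrix

/-- The negative continued fraction ⟦a₀, …, aₙ⟧ of a list of rationals: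
⟦aₙ⟧ = aₙ and ⟦aᵢ, …, aₙ⟧ = aᵢ − 1/⟦aᵢ₊₁, …, aₙ⟧, returning `none`
whenever a division by zero occurs (or the list is empty). -/
def ncf : List ℚ → Option ℚ
  | [] => none
  | [a] => some a
  | a :: b :: l =>
    (ncf (b :: l)).bind fun x => if x = 0 then none else some (a - 1 / x)

/-- The framing matrix of a linear plumbing chain with weights given by the
list `l`: a symmetric tridiagonal matrix with diagonal `l` and all sub- and
super-diagonal entries equal to `1`. -/
def tridiagL (l : List ℚ) : Matrix (Fin l.length) (Fin l.length) ℚ :=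
  Matrix.of fun i j =>
    if i = j then l.get i
    else if (i : ℕ) + 1 = (j : ℕ) ∨ (j : ℕ) + 1 = (i : ℕ) then 1 else 0

/-- Peeling off the first weight of a chain whose tail has nonzero continued fraction. -/
lemma ncf_cons_of_ncf_eq_some (a : ℚ) {l : List ℚ} {x : ℚ} (h : ncf l = some x) (hx : x ≠ 0) :
    ncf (a :: l) = some (a - 1 / x) := by
  cases l with
  | nil => simp [ncf] at h
  | cons b l => simp [ncf, h, hx]

/-- The last continued fraction of a chain is its last weight. -/
lemma ncf_drop_of_succ_eq_length {l : List ℚ} (i : Fin l.length) (hi : (i : ℕ) + 1 = l.length) :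
    ncf (l.drop i) = some (l.get i) := by
  rw [List.drop_eq_getElem_cons i.2, List.drop_eq_nil_of_le hi.ge]
  rfl

/-- The recursion satisfied by the continued fractions of the tails of a chain. -/
lemma ncf_drop_of_succ_lt_length {l : List ℚ} (i : Fin l.length) {x : ℚ}
    (h : ncf (l.drop (i + 1)) = some x) (hx : x ≠ 0) :
    ncf (l.drop i) = some (l.get i - 1 / x) := by
  rw [List.drop_eq_getElem_cons i.2]
  exact ncf_cons_of_ncf_eq_some _ h hx

/-- The unipotent upper bidiagonal matrix with superdiagonal entries `(d₁)⁻¹, …, (dₙ)⁻¹`. -/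
def bidiagInv {n : ℕ} (d : Fin n → ℚ) : Matrix (Fin n) (Fin n) ℚ :=
  Matrix.of fun i k =>
    (if i = k then 1 else 0) + (if (i : ℕ) + 1 = (k : ℕ) then (d k)⁻¹ else 0)

lemma det_bidiagInv {n : ℕ} (d : Fin n → ℚ) : (bidiagInv d).det = 1 := by
  rw [Matrix.det_of_isUpperTriangular]
  · simp [bidiagInv]
  · intro i j hij
    have hji : j < i := hij
    have h₁ : i ≠ j := hji.ne'
    have h₂ : (i : ℕ) + 1 ≠ j := by have := Fin.lt_def.mp hji; omega
    simp [bidiagInv, h₁, h₂]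

lemma bidiagInv_mul_diagonal_mul_transpose_apply {n : ℕ} {d : Fin n → ℚ} (hd : ∀ i, d i ≠ 0)
    (i j : Fin n) :
    (bidiagInv d * Matrix.diagonal d * (bidiagInv d)ᵀ) i j =
      (if i = j then d i + (if h : (i : ℕ) + 1 < n then (d ⟨i + 1, h⟩)⁻¹ else 0) else 0) +
        (if (i : ℕ) + 1 = j ∨ (j : ℕ) + 1 = i then 1 else 0) := by
  have key : ∀ k, bidiagInv d i k * d k * bidiagInv d j k =
      (if i = k then (if j = k then d k else 0) else 0) +
      (if i = k then (if (j : ℕ) + 1 = k then 1 else 0) else 0) +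
      (if j = k then (if (i : ℕ) + 1 = k then 1 else 0) else 0) +
      (if (i : ℕ) + 1 = k then (if i = j then (d k)⁻¹ else 0) else 0) := by
    intro k
    have := hd k
    simp only [bidiagInv, Matrix.of_apply, Fin.ext_iff]
    split_ifs <;> first | omega | (field_simp; try ring)
  have last : ∑ k : Fin n, (if (i : ℕ) + 1 = k then (if i = j then (d k)⁻¹ else 0) else 0) =
      if i = j then (if h : (i : ℕ) + 1 < n then (d ⟨i + 1, h⟩)⁻¹ else 0) else 0 := by
    by_cases h : (i : ℕ) + 1 < n
    · rw [Finset.sum_eq_single ⟨i + 1, h⟩]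
      · simp [h]
      · intro k _ hk
        rw [if_neg]
        exact fun h' => hk (Fin.ext h'.symm)
      · simp
    · rw [Finset.sum_eq_zero]
      · simp [h]
      · intro k _
        rw [if_neg]
        have := k.2
        omega
  rw [Matrix.mul_apply]
  simp only [Matrix.mul_diagonal, Matrix.transpose_apply, key, Finset.sum_add_distrib, last,
    Finset.sum_ite_eq, Finset.mem_univ, if_true]
  by_cases hij : i = j
  · subst hij
    simp
  · rw [if_neg (Ne.symm hij), if_neg hij, if_neg hij]
    split_ifs <;> first | omega | norm_num

/-- The `UDUᵀ` decomposition of a linear plumbing chain. -/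
lemma tridiagL_eq_bidiagInv {l : List ℚ} {d : Fin l.length → ℚ}
    (hd : ∀ i : Fin l.length, ncf (l.drop i) = some (d i)) (hd0 : ∀ i, d i ≠ 0) :
    tridiagL l = bidiagInv d * Matrix.diagonal d * (bidiagInv d)ᵀ := by
  ext i j
  rw [bidiagInv_mul_diagonal_mul_transpose_apply hd0]
  by_cases hij : i = j
  · subst hij
    have hdi := hd i
    by_cases h : (i : ℕ) + 1 < l.length
    · rw [ncf_drop_of_succ_lt_length i (hd ⟨i + 1, h⟩) (hd0 _), Option.some_inj] at hdi
      simp [tridiagL, h, ← hdi]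
    · rw [ncf_drop_of_succ_eq_length i (by omega), Option.some_inj] at hdi
      simp [tridiagL, h, ← hdi]
  · simp [tridiagL, hij]

/-- A diagonalization of a matrix by congruence gives a representation of its quadratic form
as a weighted sum of squares. -/
lemma Matrix.toQuadraticForm'_equivalent_weightedSumSquares {R V : Type*} [CommRing R] [Fintype V]
    [DecidableEq V] {A P : Matrix V V R} {w : V → R} (hP : IsUnit P.det)
    (h : A = P * Matrix.diagonal w * Pᵀ) :
    A.toQuadraticForm'.Equivalent (QuadraticMap.weightedSumSquares R w) := by
  have hPt : Invertible Pᵀ :=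
    ((Matrix.isUnit_iff_isUnit_det _).2 (by rwa [Matrix.det_transpose])).invertible
  refine ⟨⟨Matrix.toLinearEquiv' Pᵀ hPt, fun x => ?_⟩⟩
  have hx : A.toQuadraticForm' x = x ⬝ᵥ A *ᵥ x := by
    simp [Matrix.toQuadraticForm', Matrix.toLinearMap₂'_apply']
  rw [hx, h, ← Matrix.mulVec_mulVec, ← Matrix.mulVec_mulVec, Matrix.dotProduct_mulVec,
    ← Matrix.mulVec_transpose]
  simp only [QuadraticMap.weightedSumSquares_apply, dotProduct, Matrix.mulVec_diagonal, smul_eq_mul]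
  exact Finset.sum_congr rfl fun i _ => mul_left_comm _ _ _

/-- The quadratic form of a real symmetric matrix is equivalent to the sum of squares weighted by
the eigenvalues. -/
lemma Matrix.IsHermitian.toQuadraticForm'_equivalent {V : Type*} [Fintype V] [DecidableEq V]
    {A : Matrix V V ℝ} (hA : A.IsHermitian) :
    A.toQuadraticForm'.Equivalent (QuadraticMap.weightedSumSquares ℝ hA.eigenvalues) := by
  refine Matrix.toQuadraticForm'_equivalent_weightedSumSquares
    (P := (hA.eigenvectorUnitary : Matrix V V ℝ)) ?_ ?_
  · exact (Matrix.isUnit_iff_isUnit_det _).1 (Unitary.toUnits hA.eigenvectorUnitary).isUnit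
  · conv_lhs => rw [hA.spectral_theorem, Unitary.conjStarAlgAut_apply]
    rfl

section Inertia

variable {V : Type} [Fintype V] [DecidableEq V] {A P : Matrix V V ℚ} {w : V → ℚ}

lemma map_ratCast_eq_of_congruent (h : A = P * Matrix.diagonal w * Pᵀ) :
    A.map ((↑) : ℚ → ℝ) =
      P.map ((↑) : ℚ → ℝ) * Matrix.diagonal (fun i => (w i : ℝ)) * (P.map ((↑) : ℚ → ℝ))ᵀ := by
  have hd : (Matrix.diagonal w).map (Rat.castHom ℝ) = Matrix.diagonal (fun i => (w i : ℝ)) := by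
    simp [Matrix.diagonal_map]
  have hm : (P * Matrix.diagonal w * Pᵀ).map (Rat.castHom ℝ) =
      P.map (Rat.castHom ℝ) * Matrix.diagonal (fun i => (w i : ℝ)) * (P.map (Rat.castHom ℝ))ᵀ := by
    rw [Matrix.map_mul, Matrix.map_mul, hd, Matrix.transpose_map]
  rw [h]
  exact hm

lemma isHermitian_map_ratCast_of_congruent (h : A = P * Matrix.diagonal w * Pᵀ) :
    (A.map ((↑) : ℚ → ℝ)).IsHermitian := by
  rw [map_ratCast_eq_of_congruent h, Matrix.IsHermitian, Matrix.conjTranspose_eq_transpose_of_trivial]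
  simp [Matrix.transpose_mul, Matrix.mul_assoc]

lemma toQuadraticForm'_map_ratCast_equivalent (hP : IsUnit P.det)
    (h : A = P * Matrix.diagonal w * Pᵀ) :
    (A.map ((↑) : ℚ → ℝ)).toQuadraticForm'.Equivalent
      (QuadraticMap.weightedSumSquares ℝ (fun i => (w i : ℝ))) := by
  refine Matrix.toQuadraticForm'_equivalent_weightedSumSquares ?_ (map_ratCast_eq_of_congruent h)
  have := hP.map (Rat.castHom ℝ)
  rwa [RingHom.map_det] at this

/-- Sylvester's law of inertia for positive eigenvalues. -/
lemma nPosQ_eq_of_congruent (hP : IsUnit P.det) (h : A = P * Matrix.diagonal w * Pᵀ) :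
    nPosQ A = Nat.card {i // 0 < w i} := by
  have hA := isHermitian_map_ratCast_of_congruent h
  have h₁ := QuadraticForm.sigPos_of_equiv_weightedSumSquares hA.toQuadraticForm'_equivalent
  have h₂ := QuadraticForm.sigPos_of_equiv_weightedSumSquares
    (toQuadraticForm'_map_ratCast_equivalent hP h)
  simp only [Rat.cast_pos] at h₂
  rw [nPosQ, dif_pos hA]
  exact h₁.symm.trans h₂

/-- Sylvester's law of inertia for negative eigenvalues. -/
lemma nNegQ_eq_of_congruent (hP : IsUnit P.det) (h : A = P * Matrix.diagonal w * Pᵀ) :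
    nNegQ A = Nat.card {i // w i < 0} := by
  have hA := isHermitian_map_ratCast_of_congruent h
  have h₁ := QuadraticForm.sigNeg_of_equiv_weightedSumSquares hA.toQuadraticForm'_equivalent
  have h₂ := QuadraticForm.sigNeg_of_equiv_weightedSumSquares
    (toQuadraticForm'_map_ratCast_equivalent hP h)
  simp only [Rat.cast_lt_zero] at h₂
  rw [nNegQ, dif_pos hA]
  exact h₁.symm.trans h₂

end Inertia

/-- **Diagonalization of a linear plumbing chain.**
Let `l = [a₀, …, aₙ]` be a list of rationals and `T = tridiagL l` be the
associated symmetric tridiagonal matrix.  If for every `i` the negative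
continued fraction `dᵢ = ⟦aᵢ, …, aₙ⟧` is defined and nonzero, then `T` is
congruent to the diagonal matrix `diag(d₀, …, dₙ)`; in particular `n₊(T)` is
the number of indices with `dᵢ > 0` and `n₋(T)` is the number of indices with
`dᵢ < 0`. -/
theorem tridiag_congruent_diagonal_ncf
    (l : List ℚ) (hl : l ≠ [])
    (d : Fin l.length → ℚ)
    (hd : ∀ i : Fin l.length, ncf (l.drop i) = some (d i))
    (hd0 : ∀ i, d i ≠ 0) :
    (∃ L : Matrix (Fin l.length) (Fin l.length) ℚ, IsUnit L.det ∧
      tridiagL l = L * Matrix.diagonal d * Lᵀ) ∧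
    nPosQ (tridiagL l) = Nat.card {i // 0 < d i} ∧
    nNegQ (tridiagL l) = Nat.card {i // d i < 0} := by
  have hdet : IsUnit (bidiagInv d).det := by simp [det_bidiagInv]
  have hT := tridiagL_eq_bidiagInv hd hd0
  exact ⟨⟨bidiagInv d, hdet, hT⟩, nPosQ_eq_of_congruent hdet hT, nNegQ_eq_of_congruent hdet hT⟩
end

section
/- Let a, b be rational numbers and let l be a (possibly empty) list of rational numbers. Whenever both sides are defined, the negative continued fraction satisfies ⟦a − 1, −1, b − 1, l⟧ = ⟦a, b, l⟧. Consequently, applying the Neumann move (A−) along a linear chain of a plumbing tree preserves the negative continued fraction of the weight sequence of that chain. -/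
/-- Translating the leading entry translates the continued fraction. -/
theorem ncf_sub_cons (b c : ℚ) (l : List ℚ) :
    ncf ((b - c) :: l) = (ncf (b :: l)).map (· - c) := by
  cases l with
  | nil => simp [ncf]
  | cons d l =>
    simp only [ncf, Option.map_bind]
    congr 1
    funext x
    by_cases hx : x = 0
    · simp [hx]
    · simp [hx, sub_right_comm]

/-- A continued fraction of length at least two is defined exactly when its tail is defined
and nonzero. -/
theorem ncf_cons_cons_eq_some {a b y : ℚ} {l : List ℚ} :
    ncf (a :: b :: l) = some y ↔ ∃ z, ncf (b :: l) = some z ∧ z ≠ 0 ∧ a - 1 / z = y := by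
  simp [ncf, Option.bind_eq_some_iff]

/-- **Neumann move (A−) preserves negative continued fractions.**
Whenever both sides are defined, ⟦a − 1, −1, b − 1, l⟧ = ⟦a, b, l⟧.
Consequently, applying the Neumann move (A−) along a linear chain of a
plumbing tree preserves the negative continued fraction of the weight
sequence of that chain. -/
theorem ncf_move_A_neg (a b : ℚ) (l : List ℚ) (x y : ℚ)
    (h1 : ncf ((a - 1) :: (-1) :: (b - 1) :: l) = some x)
    (h2 : ncf (a :: b :: l) = some y) :
    x = y := by
  obtain ⟨z, hz, hz0, rfl⟩ := ncf_cons_cons_eq_some.1 h2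
  obtain ⟨w, hw, hw0, rfl⟩ := ncf_cons_cons_eq_some.1 h1
  obtain ⟨v, hv, hv0, rfl⟩ := ncf_cons_cons_eq_some.1 hw
  rw [ncf_sub_cons, hz, Option.map_some, Option.some.injEq] at hv
  subst hv
  have hw_eq : -1 - 1 / (z - 1) = -z / (z - 1) := by
    field_simp
    ring
  rw [hw_eq]
  field_simp
  ring
end

section
/- Let a be a rational number and let l be a (possibly empty) list of rational numbers. Whenever both sides are defined, the negative continued fraction satisfies ⟦l, a − 1, −1⟧ = ⟦l, a⟧, where ⟦l, x, y⟧ denotes the negative continued fraction of the list l with x and y appended at the end. Consequently, applying the Neumann move (B−) at the terminal vertex of a linear chain preserves the negative continued fraction of the weight sequence of that chain. -/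
theorem ncf_cons_of_ne_nil (a : ℚ) {s : List ℚ} (hs : s ≠ []) :
    ncf (a :: s) = (ncf s).bind fun x => if x = 0 then none else some (a - 1 / x) := by
  cases s with
  | nil => exact absurd rfl hs
  | cons b s => rw [ncf]

/-- The value of a negative continued fraction depends on a tail only through
the value of that tail. -/
theorem ncf_append_congr (l : List ℚ) {s t : List ℚ} (hs : s ≠ []) (ht : t ≠ [])
    (h : ncf s = ncf t) : ncf (l ++ s) = ncf (l ++ t) := by
  induction l with
  | nil => exact h
  | cons b l ih =>
    rw [List.cons_append, List.cons_append,
      ncf_cons_of_ne_nil b (List.append_ne_nil_of_right_ne_nil l hs),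
      ncf_cons_of_ne_nil b (List.append_ne_nil_of_right_ne_nil l ht), ih]

theorem ncf_sub_one_neg_one (a : ℚ) : ncf [a - 1, -1] = ncf [a] := by
  simp [ncf]

/-- **Neumann move (B−) preserves negative continued fractions.**
Whenever both sides are defined, ⟦l, a − 1, −1⟧ = ⟦l, a⟧ (with the new
entries appended at the end of the list).  Consequently, applying the Neumann
move (B−) at the terminal vertex of a linear chain preserves the negative
continued fraction of the weight sequence of that chain. -/
theorem ncf_move_B_neg (a : ℚ) (l : List ℚ) (x y : ℚ)
    (h1 : ncf (l ++ [a - 1, -1]) = some x)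
    (h2 : ncf (l ++ [a]) = some y) :
    x = y := by
  have h : ncf (l ++ [a - 1, -1]) = ncf (l ++ [a]) :=
    ncf_append_congr l (by simp) (by simp) (ncf_sub_one_neg_one a)
  exact Option.some.inj (h1.symm.trans (h.trans h2))
end

section
/- Let a, b be rational numbers and let l be a (possibly empty) list of rational numbers. Whenever both sides are defined, the negative continued fraction satisfies ⟦a, 0, b, l⟧ = ⟦a + b, l⟧. Consequently, applying the Neumann move (C), which collapses a degree-two vertex of weight 0 and merges its two neighbors into a single vertex whose weight is the sum of their weights, preserves the negative continued fraction of the weight sequence of a linear chain. -/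
/-- **Neumann move (C) preserves negative continued fractions.**
Whenever both sides are defined, ⟦a, 0, b, l⟧ = ⟦a + b, l⟧.  Consequently,
the Neumann move (C), which collapses a degree-two vertex of weight 0 and
merges its two neighbors into a single vertex whose weight is the sum of
their weights, preserves the negative continued fraction of the weight
sequence of a linear chain. -/
theorem ncf_move_C (a b : ℚ) (l : List ℚ) (x y : ℚ)
    (h1 : ncf (a :: 0 :: b :: l) = some x)
    (h2 : ncf ((a + b) :: l) = some y) :
    x = y := by
  cases l with
  | nil =>
    simp only [ncf, Option.bind_some, Option.bind_eq_some_iff, Option.ite_none_left_eq_some,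
      Option.some.injEq] at h1 h2
    obtain ⟨u, ⟨-, rfl⟩, -, rfl⟩ := h1
    rw [← h2]
    simp
  | cons c l =>
    simp only [ncf, Option.bind_eq_some_iff, Option.ite_none_left_eq_some,
      Option.some.injEq] at h1 h2
    obtain ⟨u, ⟨v, ⟨w, hw, -, rfl⟩, -, rfl⟩, -, rfl⟩ := h1
    obtain ⟨w', hw', -, rfl⟩ := h2
    obtain rfl : w = w' := Option.some.inj (hw.symm.trans hw')
    simp only [zero_sub, one_div, inv_neg, inv_inv]
    ring
end

section
/- Every weakly negative definite plumbing tree can be transformed into a negative definite plumbing tree by a finite sequence of Neumann moves: if Γ is a weakly negative definite plumbing tree, then there exist plumbing trees Γ = Γ_0, Γ_1, …, Γ_N such that each Γ_{k+1} is obtained from Γ_k by one Neumann move (or its inverse) and the framing matrix of Γ_N is negative definite. -/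
open Matrix

/-- A plumbed tree: a finite tree (on some `Fin n`) with integer vertex
weights (Euler numbers). -/
structure Plumbing where
  n : ℕ
  adj : SimpleGraph (Fin n)
  isTree : adj.IsTree
  weight : Fin n → ℤ

open Classical in
/-- The framing matrix of a plumbing tree, as a symmetric rational matrix. -/
noncomputable def framingQ (Γ : Plumbing) : Matrix (Fin Γ.n) (Fin Γ.n) ℚ :=
  Matrix.of fun i j =>
    if i = j then (Γ.weight i : ℚ) else if Γ.adj.Adj i j then 1 else 0

/-- The eigenvalues of a symmetric rational matrix, as real numbers (junk value
`0` if the matrix is not symmetric). -/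
noncomputable def eigsR {V : Type} [Fintype V] [DecidableEq V] (A : Matrix V V ℚ) : V → ℝ :=
  if h : (A.map ((↑) : ℚ → ℝ)).IsHermitian then h.eigenvalues else 0

/-- A symmetric rational matrix is negative definite iff all of its eigenvalues
are strictly negative. -/
def IsNegDefQ {V : Type} [Fintype V] [DecidableEq V] (A : Matrix V V ℚ) : Prop :=
  ∀ i, eigsR A i < 0

/-- A plumbing tree is negative definite if all eigenvalues of its framing
matrix are strictly negative. -/
def Plumbing.IsNegDef (Γ : Plumbing) : Prop := IsNegDefQ (framingQ Γ)

open Classical in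
/-- A plumbing tree is weakly negative definite if its framing matrix `B` is
invertible over `ℚ` and the principal submatrix of `B⁻¹` on the indices of the
vertices of degree at least `3` is negative definite. -/
noncomputable def Plumbing.IsWeaklyNegDef (Γ : Plumbing) : Prop :=
  IsUnit (framingQ Γ).det ∧
  IsNegDefQ ((framingQ Γ)⁻¹.submatrix
    (Subtype.val : {v : Fin Γ.n // 3 ≤ Nat.card (Γ.adj.neighborSet v)} → Fin Γ.n)
    Subtype.val)

/-- `Γ'` is obtained from `Γ` by the expansion move (Aε): the edge between the
adjacent vertices `vi`, `vj` is subdivided by a new vertex `w` of weight `ε`,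
and the weights of `vi`, `vj` each increase by `ε`; everything else is
unchanged. -/
def MoveA (ε : ℤ) (Γ Γ' : Plumbing) : Prop :=
  ∃ (f : Fin Γ.n → Fin Γ'.n) (vi vj : Fin Γ.n) (w : Fin Γ'.n),
    Function.Injective f ∧ Γ.adj.Adj vi vj ∧
    (∀ v, f v ≠ w) ∧ (∀ x, x = w ∨ ∃ v, f v = x) ∧
    Γ'.weight w = ε ∧
    Γ'.weight (f vi) = Γ.weight vi + ε ∧
    Γ'.weight (f vj) = Γ.weight vj + ε ∧
    (∀ v, v ≠ vi → v ≠ vj → Γ'.weight (f v) = Γ.weight v) ∧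
    (∀ v, Γ'.adj.Adj w (f v) ↔ (v = vi ∨ v = vj)) ∧
    (∀ a b, Γ'.adj.Adj (f a) (f b) ↔
      (Γ.adj.Adj a b ∧ ¬(a = vi ∧ b = vj) ∧ ¬(a = vj ∧ b = vi)))

/-- `Γ'` is obtained from `Γ` by the expansion move (Bε): a new leaf `w` of
weight `ε` is attached to the vertex `vi`, whose weight increases by `ε`;
everything else is unchanged. -/
def MoveB (ε : ℤ) (Γ Γ' : Plumbing) : Prop :=
  ∃ (f : Fin Γ.n → Fin Γ'.n) (vi : Fin Γ.n) (w : Fin Γ'.n),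
    Function.Injective f ∧
    (∀ v, f v ≠ w) ∧ (∀ x, x = w ∨ ∃ v, f v = x) ∧
    Γ'.weight w = ε ∧
    Γ'.weight (f vi) = Γ.weight vi + ε ∧
    (∀ v, v ≠ vi → Γ'.weight (f v) = Γ.weight v) ∧
    (∀ v, Γ'.adj.Adj w (f v) ↔ v = vi) ∧
    (∀ a b, Γ'.adj.Adj (f a) (f b) ↔ Γ.adj.Adj a b)

/-- `Γ'` is obtained from `Γ` by the expansion move inverse to (C): the vertex
`vi` of weight `m₁ + m₂` is replaced by a chain `f vi − w − w''`, where `w`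
has weight `0`, `f vi` has weight `m₁`, `w''` has weight `m₂`, and each former
neighbor of `vi` is joined to exactly one of `f vi`, `w''` according to the
partition given by the predicate `P`; everything else is unchanged. -/
def MoveC (Γ Γ' : Plumbing) : Prop :=
  ∃ (f : Fin Γ.n → Fin Γ'.n) (vi : Fin Γ.n) (w w'' : Fin Γ'.n)
    (m₁ m₂ : ℤ) (P : Fin Γ.n → Prop),
    Function.Injective f ∧ w ≠ w'' ∧
    (∀ v, f v ≠ w) ∧ (∀ v, f v ≠ w'') ∧
    (∀ x, x = w ∨ x = w'' ∨ ∃ v, f v = x) ∧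
    m₁ + m₂ = Γ.weight vi ∧
    Γ'.weight (f vi) = m₁ ∧ Γ'.weight w'' = m₂ ∧ Γ'.weight w = 0 ∧
    (∀ v, v ≠ vi → Γ'.weight (f v) = Γ.weight v) ∧
    (∀ x, Γ'.adj.Adj w x ↔ (x = f vi ∨ x = w'')) ∧
    (∀ v, Γ'.adj.Adj w'' (f v) ↔ (v ≠ vi ∧ Γ.adj.Adj v vi ∧ ¬ P v)) ∧
    (∀ v, v ≠ vi → (Γ'.adj.Adj (f v) (f vi) ↔ (Γ.adj.Adj v vi ∧ P v))) ∧
    (∀ a b, a ≠ vi → b ≠ vi → (Γ'.adj.Adj (f a) (f b) ↔ Γ.adj.Adj a b))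

/-- One Neumann move or its inverse: one of the moves (A±), (B±), (C),
performed in either direction. -/
def NeumannStep (Γ Γ' : Plumbing) : Prop :=
  (∃ ε : ℤ, (ε = 1 ∨ ε = -1) ∧
    (MoveA ε Γ Γ' ∨ MoveA ε Γ' Γ ∨ MoveB ε Γ Γ' ∨ MoveB ε Γ' Γ)) ∨
  MoveC Γ Γ' ∨ MoveC Γ' Γ

/-- The vertex `v` has at most two neighbors. -/
def AtMostTwoNeighbors {V : Type} (G : SimpleGraph V) (v : V) : Prop :=
  ∃ a b, ∀ x, G.Adj v x → x = a ∨ x = b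

theorem AtMostTwoNeighbors.of_map {V V' : Type} {G : SimpleGraph V} {G' : SimpleGraph V'}
    {v : V} {v' : V'} (ρ : V' → V) (h : AtMostTwoNeighbors G' v')
    (hρ : ∀ x, G.Adj v x → ∃ z, G'.Adj v' z ∧ ρ z = x) : AtMostTwoNeighbors G v := by
  obtain ⟨a, b, hab⟩ := h
  refine ⟨ρ a, ρ b, fun x hx => ?_⟩
  obtain ⟨z, hz, rfl⟩ := hρ x hx
  rcases hab z hz with rfl | rfl <;> simp

theorem AtMostTwoNeighbors.exists_other {V : Type} {G : SimpleGraph V} {v w : V}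
    (h : AtMostTwoNeighbors G v) (hw : G.Adj v w) : ∃ a, ∀ x, G.Adj v x → x = w ∨ x = a := by
  obtain ⟨a, b, hab⟩ := h
  rcases hab w hw with rfl | rfl
  · exact ⟨b, hab⟩
  · exact ⟨a, fun x hx => (hab x hx).symm⟩

theorem AtMostTwoNeighbors.cases {V : Type} {G : SimpleGraph V} {v : V}
    (h : AtMostTwoNeighbors G v) :
    (∀ x, ¬ G.Adj v x) ∨ (∃ a, ∀ x, G.Adj v x ↔ x = a) ∨
      ∃ a b, a ≠ b ∧ ∀ x, G.Adj v x ↔ (x = a ∨ x = b) := by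
  by_cases h0 : ∀ x, ¬ G.Adj v x
  · exact .inl h0
  push Not at h0
  obtain ⟨a, ha⟩ := h0
  obtain ⟨b, hb⟩ := h.exists_other ha
  by_cases hab : G.Adj v b ∧ a ≠ b
  · refine .inr (.inr ⟨a, b, hab.2, fun x => ⟨hb x, ?_⟩⟩)
    rintro (rfl | rfl)
    exacts [ha, hab.1]
  · refine .inr (.inl ⟨a, fun x => ⟨fun hx => ?_, ?_⟩⟩)
    · rcases hb x hx with rfl | rfl
      · rfl
      · by_contra hne
        exact hab ⟨hx, fun h => hne h.symm⟩
    · rintro rfl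
      exact ha

theorem SimpleGraph.Connected.of_map {V V' : Type} {G : SimpleGraph V} {G' : SimpleGraph V'}
    (hG : G.Connected) (g : V → V') (hg : ∀ a b, G.Adj a b → G'.Reachable (g a) (g b))
    (hc : ∀ x, ∃ v, G'.Reachable (g v) x) : G'.Connected := by
  have hr : ∀ a b, G.Reachable a b → G'.Reachable (g a) (g b) := by
    rintro a b ⟨p⟩
    induction p with
    | nil => rfl
    | cons h _ ih => exact (hg _ _ h).trans ih
  have := hG.nonempty
  refine SimpleGraph.connected_iff _ |>.2 ⟨fun x y => ?_, this.map g⟩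
  obtain ⟨a, ha⟩ := hc x
  obtain ⟨b, hb⟩ := hc y
  exact ha.symm.trans ((hr a b (hG.preconnected a b)).trans hb)

/-- Removing the edge `s(w, u)` from a tree splits off the component `S` of `u`. -/
theorem SimpleGraph.IsTree.exists_cut {V : Type} {G : SimpleGraph V} (hG : G.IsTree) {w u : V}
    (h : G.Adj w u) : ∃ S : Set V, u ∈ S ∧ w ∉ S ∧
      (∀ a b, G.Adj a b → a ≠ w → b ≠ w → (a ∈ S ↔ b ∈ S)) ∧
      ∀ b, G.Adj w b → b ≠ u → b ∉ S := by
  have hb := SimpleGraph.isAcyclic_iff_forall_isBridge.1 hG.isAcyclic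
    (e := s(w, u)) (by simpa using h)
  rw [SimpleGraph.isBridge_iff] at hb
  set H := G \ SimpleGraph.fromEdgeSet {s(w, u)} with hH
  have key : ∀ a b, G.Adj a b → s(a, b) ≠ s(w, u) → H.Adj a b := by
    intro a b hab hne
    simp only [hH, SimpleGraph.sdiff_adj, SimpleGraph.fromEdgeSet_adj, Set.mem_singleton_iff]
    exact ⟨hab, fun h => hne h.1⟩
  refine ⟨{x | H.Reachable u x}, by simp, fun h' => hb ?_, fun a b hab ha hb' => ?_,
    fun b hwb hbu hub => hb ?_⟩
  · exact SimpleGraph.Reachable.symm h'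
  · have := (key a b hab (by simp [ha, hb'])).reachable
    exact ⟨fun h => h.trans this, fun h => h.trans this.symm⟩
  · have := (key w b hwb (by simp [hbu, h.ne])).reachable
    exact this.trans (SimpleGraph.Reachable.symm hub)

section Graph

variable {V V' : Type} [Fintype V] [Fintype V']

open Classical in
/-- The sum of `x` over the neighbors of `v`. -/
noncomputable def neighborSum (G : SimpleGraph V) (x : V → ℝ) (v : V) : ℝ :=
  ∑ u, if G.Adj v u then x u else 0

theorem sum_eq_add_sum_of_cover (f : V → V') (w : V') (hf : Function.Injective f)
    (hw : ∀ v, f v ≠ w) (hc : ∀ x, x = w ∨ ∃ v, f v = x) (g : V' → ℝ) :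
    ∑ x, g x = g w + ∑ v, g (f v) := by
  have hb : Function.Bijective (fun o : Option V => o.elim w f) := by
    constructor
    · rintro (_ | a) (_ | b) h
      · rfl
      · exact absurd h.symm (hw b)
      · exact absurd h (hw a)
      · exact congrArg some (hf h)
    · intro x
      rcases hc x with rfl | ⟨v, rfl⟩
      exacts [⟨none, rfl⟩, ⟨some v, rfl⟩]
  rw [← (Equiv.ofBijective _ hb).sum_comp, Fintype.sum_option]
  rfl

theorem sum_eq_add_add_sum_of_cover (f : V → V') (w u : V') (hf : Function.Injective f)
    (hwu : w ≠ u) (hw : ∀ v, f v ≠ w) (hu : ∀ v, f v ≠ u)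
    (hc : ∀ x, x = w ∨ x = u ∨ ∃ v, f v = x) (g : V' → ℝ) :
    ∑ x, g x = g w + (g u + ∑ v, g (f v)) := by
  rw [sum_eq_add_sum_of_cover (fun o : Option V => o.elim u f) w, Fintype.sum_option]
  · rfl
  · rintro (_ | a) (_ | b) h
    · rfl
    · exact absurd h.symm (hu b)
    · exact absurd h (hu a)
    · exact congrArg some (hf h)
  · rintro (_ | a)
    exacts [hwu.symm, hw a]
  · intro x
    rcases hc x with rfl | rfl | ⟨v, rfl⟩
    exacts [.inl rfl, .inr ⟨none, rfl⟩, .inr ⟨some v, rfl⟩]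

theorem isTree_iff_connected_and_sum (G : SimpleGraph V) :
    G.IsTree ↔ G.Connected ∧ ∑ v, neighborSum G 1 v + 2 = 2 * Fintype.card V := by
  classical
  have h : ∑ v, neighborSum G 1 v = 2 * (Nat.card G.edgeSet : ℝ) := by
    have h1 := G.sum_degrees_eq_twice_card_edges
    have h2 : ∀ v, neighborSum G 1 v = G.degree v := by
      intro v
      simp only [neighborSum, Pi.one_apply, Finset.sum_boole,
        ← SimpleGraph.card_neighborFinset_eq_degree]
      congr 2
      ext x
      simp
    simp only [h2]
    rw [Nat.card_eq_fintype_card, ← SimpleGraph.edgeFinset_card]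
    exact_mod_cast h1
  rw [SimpleGraph.isTree_iff_connected_and_card, h, Nat.card_eq_fintype_card (α := V)]
  refine and_congr_right fun _ => ?_
  rw [← @Nat.cast_inj ℝ]
  push_cast
  constructor <;> intro h <;> linarith

/-- `G'` is `G` with the edge `s(i, j)` subdivided by the new vertex `w`. -/
structure Subdivides {V V' : Type} (G : SimpleGraph V) (G' : SimpleGraph V') (f : V → V')
    (i j : V) (w : V') : Prop where
  inj : Function.Injective f
  ne : ∀ v, f v ≠ w
  cover : ∀ x, x = w ∨ ∃ v, f v = x
  adj_ij : G.Adj i j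
  adj_new : ∀ v, G'.Adj w (f v) ↔ (v = i ∨ v = j)
  adj : ∀ a b, G'.Adj (f a) (f b) ↔ (G.Adj a b ∧ ¬(a = i ∧ b = j) ∧ ¬(a = j ∧ b = i))

/-- `G'` is `G` with a new leaf `w` attached to `i`. -/
structure Attaches {V V' : Type} (G : SimpleGraph V) (G' : SimpleGraph V') (f : V → V')
    (i : V) (w : V') : Prop where
  inj : Function.Injective f
  ne : ∀ v, f v ≠ w
  cover : ∀ x, x = w ∨ ∃ v, f v = x
  adj_new : ∀ v, G'.Adj w (f v) ↔ v = i
  adj : ∀ a b, G'.Adj (f a) (f b) ↔ G.Adj a b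

/-- `G'` is `G` with the vertex `c` replaced by a chain `f c − w − u`. -/
structure Splits {V V' : Type} (G : SimpleGraph V) (G' : SimpleGraph V') (f : V → V')
    (c : V) (w u : V') (P : V → Prop) : Prop where
  inj : Function.Injective f
  ne_wu : w ≠ u
  ne_w : ∀ v, f v ≠ w
  ne_u : ∀ v, f v ≠ u
  cover : ∀ x, x = w ∨ x = u ∨ ∃ v, f v = x
  adj_w : ∀ x, G'.Adj w x ↔ (x = f c ∨ x = u)
  adj_u : ∀ v, G'.Adj u (f v) ↔ (v ≠ c ∧ G.Adj v c ∧ ¬ P v)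
  adj_c : ∀ v, v ≠ c → (G'.Adj (f v) (f c) ↔ (G.Adj v c ∧ P v))
  adj : ∀ a b, a ≠ c → b ≠ c → (G'.Adj (f a) (f b) ↔ G.Adj a b)

namespace Subdivides

variable {G : SimpleGraph V} {G' : SimpleGraph V'} {f : V → V'} {i j : V} {w : V'}

theorem neighborSum_new (h : Subdivides G G' f i j w) (x : V' → ℝ) :
    neighborSum G' x w = x (f i) + x (f j) := by
  classical
  have hij := h.adj_ij.ne
  rw [neighborSum, sum_eq_add_sum_of_cover f w h.inj h.ne h.cover]
  simp only [h.adj_new, SimpleGraph.irrefl, if_false, zero_add]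
  have : ∀ v, (if v = i ∨ v = j then x (f v) else 0)
      = (if v = i then x (f v) else 0) + (if v = j then x (f v) else 0) := by
    intro v
    by_cases h1 : v = i
    · subst h1; simp [hij]
    · simp [h1]
  simp [this, Finset.sum_add_distrib]

open Classical in
theorem neighborSum_old (h : Subdivides G G' f i j w) (x : V' → ℝ) (v : V) :
    neighborSum G' x (f v) = neighborSum G (x ∘ f) v +
      ((if v = i then x w - x (f j) else 0) + (if v = j then x w - x (f i) else 0)) := by
  have hij := h.adj_ij.ne
  have hij' := h.adj_ij
  rw [neighborSum, neighborSum, sum_eq_add_sum_of_cover f w h.inj h.ne h.cover]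
  simp only [G'.adj_comm (f v) w, h.adj_new, h.adj]
  have : ∀ u, (if G.Adj v u ∧ ¬(v = i ∧ u = j) ∧ ¬(v = j ∧ u = i) then x (f u) else 0)
      = (if G.Adj v u then (x ∘ f) u else 0) - ((if u = j then (if v = i then x (f u) else 0) else 0)
        + (if u = i then (if v = j then x (f u) else 0) else 0)) := by
    intro u
    by_cases h1 : v = i
    · subst h1
      by_cases h2 : u = j
      · subst h2; simp [hij, hij', hij.symm]
      · simp [hij, h2]
    · by_cases h2 : v = j
      · subst h2
        by_cases h3 : u = i
        · subst h3; simp [hij, hij'.symm, hij.symm]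
        · simp [hij.symm, h3]
      · simp [h1, h2]
  simp only [this, Finset.sum_sub_distrib, Finset.sum_add_distrib, Finset.sum_ite_eq',
    Finset.mem_univ, if_true]
  by_cases h1 : v = i
  · subst h1; simp [hij]; ring
  · by_cases h2 : v = j
    · subst h2; simp [hij.symm]; ring
    · simp [h1, h2]

theorem sum_neighborSum (h : Subdivides G G' f i j w) :
    ∑ v, neighborSum G' 1 v = ∑ v, neighborSum G 1 v + 2 := by
  classical
  rw [sum_eq_add_sum_of_cover f w h.inj h.ne h.cover, h.neighborSum_new]
  simp only [h.neighborSum_old]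
  simp
  ring

end Subdivides

theorem card_eq_of_cover (f : V → V') (w : V') (hf : Function.Injective f)
    (hw : ∀ v, f v ≠ w) (hc : ∀ x, x = w ∨ ∃ v, f v = x) :
    (Fintype.card V' : ℝ) = Fintype.card V + 1 := by
  have := sum_eq_add_sum_of_cover f w hf hw hc 1
  simp at this
  linarith

namespace Subdivides

variable {G : SimpleGraph V} {G' : SimpleGraph V'} {f : V → V'} {i j : V} {w : V'}

theorem isTree (h : Subdivides G G' f i j w) (hG : G.IsTree) : G'.IsTree := by
  rw [isTree_iff_connected_and_sum] at *
  have hi : G'.Adj w (f i) := (h.adj_new i).2 (.inl rfl)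
  have hj : G'.Adj w (f j) := (h.adj_new j).2 (.inr rfl)
  refine ⟨hG.1.of_map f (fun a b hab => ?_) fun x => ?_, ?_⟩
  · by_cases h1 : a = i ∧ b = j
    · rw [h1.1, h1.2]
      exact hi.symm.reachable.trans hj.reachable
    by_cases h2 : a = j ∧ b = i
    · rw [h2.1, h2.2]
      exact hj.symm.reachable.trans hi.reachable
    exact ((h.adj a b).2 ⟨hab, h1, h2⟩).reachable
  · rcases h.cover x with rfl | ⟨v, rfl⟩
    exacts [⟨i, hi.symm.reachable⟩, ⟨v, .rfl⟩]
  · rw [h.sum_neighborSum, card_eq_of_cover f w h.inj h.ne h.cover]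
    linarith [hG.2]

theorem isTree_of_subdivided (h : Subdivides G G' f i j w) (hG : G'.IsTree) : G.IsTree := by
  classical
  rw [isTree_iff_connected_and_sum] at *
  have : Nonempty V := ⟨i⟩
  obtain ⟨r, hr⟩ := h.inj.hasLeftInverse
  refine ⟨hG.1.of_map (fun z => if z = w then i else r z) (fun a b hab => ?_) fun x => ?_, ?_⟩
  · rcases h.cover a with rfl | ⟨a, rfl⟩ <;> rcases h.cover b with rfl | ⟨b, rfl⟩
    · simp
    · simp only [if_true, h.ne, if_false, hr b]
      rcases (h.adj_new b).1 hab with rfl | rfl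
      exacts [.rfl, h.adj_ij.reachable]
    · simp only [if_true, h.ne, if_false, hr a]
      rcases (h.adj_new a).1 hab.symm with rfl | rfl
      exacts [.rfl, h.adj_ij.symm.reachable]
    · simp only [h.ne, if_false, hr a, hr b]
      exact ((h.adj a b).1 hab).1.reachable
  · exact ⟨f x, by simp [h.ne, hr x]⟩
  · have := hG.2
    rw [h.sum_neighborSum, card_eq_of_cover f w h.inj h.ne h.cover] at this
    linarith

end Subdivides

namespace Attaches

variable {G : SimpleGraph V} {G' : SimpleGraph V'} {f : V → V'} {i : V} {w : V'}

theorem neighborSum_new (h : Attaches G G' f i w) (x : V' → ℝ) :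
    neighborSum G' x w = x (f i) := by
  classical
  rw [neighborSum, sum_eq_add_sum_of_cover f w h.inj h.ne h.cover]
  simp [h.adj_new]

open Classical in
theorem neighborSum_old (h : Attaches G G' f i w) (x : V' → ℝ) (v : V) :
    neighborSum G' x (f v) = neighborSum G (x ∘ f) v + if v = i then x w else 0 := by
  rw [neighborSum, neighborSum, sum_eq_add_sum_of_cover f w h.inj h.ne h.cover]
  simp only [G'.adj_comm (f v) w, h.adj_new, h.adj]
  rw [add_comm]
  rfl

theorem isTree (h : Attaches G G' f i w) (hG : G.IsTree) : G'.IsTree := by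
  classical
  rw [isTree_iff_connected_and_sum] at *
  refine ⟨hG.1.of_map f (fun a b hab => ((h.adj a b).2 hab).reachable) fun x => ?_, ?_⟩
  · rcases h.cover x with rfl | ⟨v, rfl⟩
    exacts [⟨i, ((h.adj_new i).2 rfl).symm.reachable⟩, ⟨v, .rfl⟩]
  · rw [sum_eq_add_sum_of_cover f w h.inj h.ne h.cover, h.neighborSum_new,
      card_eq_of_cover f w h.inj h.ne h.cover]
    simp only [h.neighborSum_old, Finset.sum_add_distrib]
    have : (1 : V' → ℝ) ∘ f = 1 := rfl
    simp only [this, Finset.sum_ite_eq', Finset.mem_univ, if_true, Pi.one_apply]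
    linarith [hG.2]

end Attaches

namespace Splits

variable {G : SimpleGraph V} {G' : SimpleGraph V'} {f : V → V'} {c : V} {w u : V'} {P : V → Prop}

open Classical in
theorem neighborSum_w (h : Splits G G' f c w u P) (x : V' → ℝ) :
    neighborSum G' x w = x (f c) + x u := by
  rw [neighborSum, sum_eq_add_add_sum_of_cover f w u h.inj h.ne_wu h.ne_w h.ne_u h.cover]
  simp [h.adj_w, h.ne_u, h.inj.eq_iff, add_comm]

open Classical in
theorem neighborSum_u (h : Splits G G' f c w u P) (x : V' → ℝ) :
    neighborSum G' x u = x w + ∑ v, if G.Adj v c ∧ ¬ P v then x (f v) else 0 := by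
  rw [neighborSum, sum_eq_add_add_sum_of_cover f w u h.inj h.ne_wu h.ne_w h.ne_u h.cover]
  simp only [G'.adj_comm u w, h.adj_w, or_true, if_true, SimpleGraph.irrefl, if_false, zero_add,
    h.adj_u]
  congr 1
  refine Finset.sum_congr rfl fun v _ => if_congr ?_ rfl rfl
  exact ⟨fun h => h.2, fun h => ⟨h.1.ne, h⟩⟩

open Classical in
theorem neighborSum_c (h : Splits G G' f c w u P) (x : V' → ℝ) :
    neighborSum G' x (f c) = x w + ∑ v, if G.Adj v c ∧ P v then x (f v) else 0 := by
  rw [neighborSum, sum_eq_add_add_sum_of_cover f w u h.inj h.ne_wu h.ne_w h.ne_u h.cover]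
  have : ¬ G'.Adj (f c) u := by
    rw [G'.adj_comm, h.adj_u]; simp
  simp only [G'.adj_comm (f c) w, h.adj_w, true_or, if_true, this, if_false, zero_add]
  congr 1
  refine Finset.sum_congr rfl fun v _ => if_congr ?_ rfl rfl
  by_cases hv : v = c
  · subst hv; simp
  · rw [G'.adj_comm, h.adj_c v hv]

open Classical in
theorem neighborSum_old (h : Splits G G' f c w u P) (x : V' → ℝ) {v : V} (hv : v ≠ c) :
    neighborSum G' x (f v) = ∑ z, if G.Adj v z then
      (if z = c then (if P v then x (f c) else x u) else x (f z)) else 0 := by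
  rw [neighborSum, sum_eq_add_add_sum_of_cover f w u h.inj h.ne_wu h.ne_w h.ne_u h.cover]
  have h1 : ¬ G'.Adj (f v) w := by
    rw [G'.adj_comm, h.adj_w]; simp [h.ne_u, h.inj.eq_iff, hv]
  have h2 : ∀ z, (if G'.Adj (f v) (f z) then x (f z) else 0) = (if G.Adj v z then
      (if z = c then (if P v then x (f c) else x u) else x (f z)) else 0) -
      if z = c then (if G.Adj v c ∧ ¬ P v then x u else 0) else 0 := by
    intro z
    by_cases hz : z = c
    · subst hz
      rw [h.adj_c v hv]
      by_cases hP : P v <;> simp [hP]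
    · simp [hz, h.adj v z hv hz]
  rw [if_neg h1, zero_add]
  simp only [h2, Finset.sum_sub_distrib, Finset.sum_ite_eq', Finset.mem_univ, if_true]
  simp [G'.adj_comm (f v) u, h.adj_u, hv]

theorem sum_neighborSum (h : Splits G G' f c w u P) :
    ∑ v, neighborSum G' 1 v = ∑ v, neighborSum G 1 v + 4 := by
  classical
  rw [sum_eq_add_add_sum_of_cover f w u h.inj h.ne_wu h.ne_w h.ne_u h.cover, h.neighborSum_w,
    h.neighborSum_u, Fintype.sum_eq_add_sum_compl c (fun v => neighborSum G' 1 (f v)),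
    h.neighborSum_c,
    Fintype.sum_eq_add_sum_compl c (fun v => neighborSum G 1 v)]
  have h1 : ∀ v ∈ ({c}ᶜ : Finset V), neighborSum G' 1 (f v) = neighborSum G 1 v := by
    intro v hv
    rw [h.neighborSum_old _ (by simpa using hv), neighborSum]
    simp
  rw [Finset.sum_congr rfl h1]
  have h2 : neighborSum G 1 c = (∑ v, if G.Adj v c ∧ ¬ P v then (1 : ℝ) else 0) +
      ∑ v, if G.Adj v c ∧ P v then (1 : ℝ) else 0 := by
    rw [← Finset.sum_add_distrib, neighborSum]
    refine Finset.sum_congr rfl fun v _ => ?_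
    rw [G.adj_comm]
    by_cases hP : P v <;> simp [hP]
  rw [h2]
  simp only [Pi.one_apply]
  ring

theorem isTree_of_split (h : Splits G G' f c w u P) (hG : G'.IsTree) : G.IsTree := by
  classical
  have hcard : (Fintype.card V' : ℝ) = Fintype.card V + 2 := by
    have := sum_eq_add_add_sum_of_cover f w u h.inj h.ne_wu h.ne_w h.ne_u h.cover 1
    simp at this
    linarith
  rw [isTree_iff_connected_and_sum] at *
  have : Nonempty V := ⟨c⟩
  obtain ⟨r, hr⟩ := h.inj.hasLeftInverse
  have hw : ∀ v, G'.Adj w (f v) → v = c := by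
    intro v hv
    rcases (h.adj_w _).1 hv with h' | h'
    exacts [h.inj h', absurd h' (h.ne_u v)]
  refine ⟨hG.1.of_map (fun z => if z = w ∨ z = u then c else r z) (fun a b hab => ?_)
    fun x => ?_, ?_⟩
  · rcases h.cover a with rfl | rfl | ⟨a, rfl⟩ <;> rcases h.cover b with rfl | rfl | ⟨b, rfl⟩
    · simp
    · simp
    · simp [h.ne_w, h.ne_u, hw b hab, hr c]
    · simp
    · simp
    · simp only [or_true, if_true, h.ne_w, h.ne_u, or_false, if_false, hr b]
      exact ((h.adj_u b).1 hab).2.1.symm.reachable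
    · simp [h.ne_w, h.ne_u, hw a hab.symm, hr c]
    · simp only [or_true, if_true, h.ne_w, h.ne_u, or_false, if_false, hr a]
      exact ((h.adj_u a).1 hab.symm).2.1.reachable
    · simp only [h.ne_w, h.ne_u, or_false, if_false, hr a, hr b]
      by_cases ha : a = c
      · subst ha
        by_cases hb : b = a
        · subst hb; rfl
        · exact ((h.adj_c b hb).1 hab.symm).1.symm.reachable
      · by_cases hb : b = c
        · subst hb
          exact ((h.adj_c a ha).1 hab).1.reachable
        · exact ((h.adj a b ha hb).1 hab).reachable
  · exact ⟨f x, by simp [h.ne_w, h.ne_u, hr x]⟩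
  · have := hG.2
    rw [h.sum_neighborSum, hcard] at this
    linarith

end Splits

end Graph

namespace Plumbing

/-- The action of the framing matrix on real vectors. -/
noncomputable def lin (Γ : Plumbing) (x : Fin Γ.n → ℝ) (v : Fin Γ.n) : ℝ :=
  Γ.weight v * x v + neighborSum Γ.adj x v

/-- The real quadratic form of the framing matrix. -/
noncomputable def quad (Γ : Plumbing) (x : Fin Γ.n → ℝ) : ℝ :=
  ∑ v, x v * Γ.lin x v

variable (Γ : Plumbing)

theorem lin_add (x y : Fin Γ.n → ℝ) (v : Fin Γ.n) :
    Γ.lin (x + y) v = Γ.lin x v + Γ.lin y v := by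
  have : neighborSum Γ.adj (x + y) v = neighborSum Γ.adj x v + neighborSum Γ.adj y v := by
    simp only [neighborSum, ← Finset.sum_add_distrib, Pi.add_apply]
    refine Finset.sum_congr rfl fun u _ => ?_
    split_ifs <;> simp
  simp only [lin, this, Pi.add_apply]
  ring

theorem lin_smul (c : ℝ) (x : Fin Γ.n → ℝ) (v : Fin Γ.n) :
    Γ.lin (c • x) v = c * Γ.lin x v := by
  simp only [lin, neighborSum, Pi.smul_apply, smul_eq_mul, mul_add, Finset.mul_sum, mul_ite,
    mul_zero]
  ring

theorem sum_mul_lin_comm (x y : Fin Γ.n → ℝ) :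
    ∑ v, x v * Γ.lin y v = ∑ v, y v * Γ.lin x v := by
  simp only [lin, neighborSum, mul_add, Finset.sum_add_distrib, Finset.mul_sum]
  congr 1
  · exact Finset.sum_congr rfl fun v _ => by ring
  · rw [Finset.sum_comm]
    refine Finset.sum_congr rfl fun v _ => Finset.sum_congr rfl fun u _ => ?_
    rw [Γ.adj.adj_comm]
    split_ifs <;> ring

theorem quad_add (x y : Fin Γ.n → ℝ) :
    Γ.quad (x + y) = Γ.quad x + 2 * ∑ v, y v * Γ.lin x v + Γ.quad y := by
  have : Γ.quad (x + y) = Γ.quad x + ∑ v, y v * Γ.lin x v + (∑ v, x v * Γ.lin y v + Γ.quad y) := by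
    simp only [quad, ← Finset.sum_add_distrib, lin_add, Pi.add_apply]
    exact Finset.sum_congr rfl fun v _ => by ring
  rw [this, Γ.sum_mul_lin_comm x y]
  ring

theorem quad_smul (c : ℝ) (x : Fin Γ.n → ℝ) : Γ.quad (c • x) = c ^ 2 * Γ.quad x := by
  simp only [quad, lin_smul, Pi.smul_apply, smul_eq_mul, Finset.mul_sum]
  exact Finset.sum_congr rfl fun v _ => by ring

theorem neighborSum_single {V : Type} [Fintype V] [DecidableEq V] (G : SimpleGraph V)
    [DecidableRel G.Adj] (u v : V) (c : ℝ) :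
    neighborSum G (Pi.single u c) v = if G.Adj v u then c else 0 := by
  rw [neighborSum, Finset.sum_eq_single u] <;> simp +contextual

theorem quad_single (v : Fin Γ.n) (c : ℝ) : Γ.quad (Pi.single v c) = Γ.weight v * c ^ 2 := by
  classical
  rw [quad, Finset.sum_eq_single v]
  · simp [lin, neighborSum_single]
    ring
  · intro u _ hu
    simp [hu]
  · simp

/-- `N` contains all the vertices with at least three neighbors, the form of `Γ` is negative
definite on the vectors whose image is supported on `N`, and it is nonpositive on a subspace of
codimension at most `k`. -/
structure NegDefModulo (N : Set (Fin Γ.n)) (k : ℕ) : Prop where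
  low : ∀ v ∉ N, AtMostTwoNeighbors Γ.adj v
  neg : ∀ x ≠ 0, (∀ v ∉ N, Γ.lin x v = 0) → Γ.quad x < 0
  pos : ∃ l : (Fin Γ.n → ℝ) →ₗ[ℝ] (Fin k → ℝ), ∀ x, l x = 0 → Γ.quad x ≤ 0

/-- The effect on the framing matrix of blowing up `Γ` by a new vertex `w` of weight `-1`
adjacent to the vertices in `I`. -/
structure IsBlowUp (Γ Γ' : Plumbing) (f : Fin Γ.n → Fin Γ'.n) (w : Fin Γ'.n)
    (I : Finset (Fin Γ.n)) : Prop where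
  inj : Function.Injective f
  ne : ∀ v, f v ≠ w
  cover : ∀ x, x = w ∨ ∃ v, f v = x
  lin_new : ∀ x, Γ'.lin x w = ∑ v ∈ I, x (f v) - x w
  lin_old : ∀ x v, Γ'.lin x (f v) = Γ.lin (x ∘ f) v - if v ∈ I then Γ'.lin x w else 0

namespace IsBlowUp

variable {Γ} {Γ' : Plumbing} {f : Fin Γ.n → Fin Γ'.n} {w : Fin Γ'.n} {I : Finset (Fin Γ.n)}

theorem quad_eq (h : IsBlowUp Γ Γ' f w I) (x : Fin Γ'.n → ℝ) :
    Γ'.quad x = Γ.quad (x ∘ f) - Γ'.lin x w ^ 2 := by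
  rw [quad, sum_eq_add_sum_of_cover f w h.inj h.ne h.cover]
  simp only [h.lin_old, mul_sub, Finset.sum_sub_distrib, mul_ite, mul_zero, Finset.sum_ite_mem,
    Finset.univ_inter, ← Finset.sum_mul]
  have : ∑ v ∈ I, x (f v) = Γ'.lin x w + x w := by rw [h.lin_new]; ring
  rw [this, quad]
  simp only [Function.comp]
  ring

theorem exists_lift (h : IsBlowUp Γ Γ' f w I) :
    ∃ φ : (Fin Γ.n → ℝ) →ₗ[ℝ] (Fin Γ'.n → ℝ), ∀ y, φ y ∘ f = y ∧ Γ'.lin (φ y) w = 0 := by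
  by_cases hn : Nonempty (Fin Γ.n)
  · obtain ⟨r, hr⟩ := h.inj.hasLeftInverse
    refine ⟨{ toFun := fun y z => if z = w then ∑ v ∈ I, y v else y (r z)
              map_add' := ?_, map_smul' := ?_ }, fun y => ⟨?_, ?_⟩⟩
    · intro x y
      ext z
      simp only [Pi.add_apply, Finset.sum_add_distrib]
      split_ifs <;> rfl
    · intro c x
      ext z
      simp only [Pi.smul_apply, smul_eq_mul, RingHom.id_apply]
      split_ifs
      exacts [(Finset.mul_sum ..).symm, rfl]
    · ext v
      simp [h.ne, hr v]
    · rw [h.lin_new]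
      simp [h.ne, hr _]
  · refine ⟨0, fun y => ⟨?_, ?_⟩⟩
    · ext v
      exact (hn ⟨v⟩).elim
    · simp [lin, neighborSum]

theorem up (h : IsBlowUp Γ Γ' f w I) {N : Set (Fin Γ.n)} {k : ℕ} (hΓ : Γ.NegDefModulo N k)
    (hlow : ∀ v ∉ f '' N, AtMostTwoNeighbors Γ'.adj v) : Γ'.NegDefModulo (f '' N) k := by
  refine ⟨hlow, fun x hx hx' => ?_, ?_⟩
  · have hw : Γ'.lin x w = 0 := hx' w (by rintro ⟨v, -, hv⟩; exact h.ne v hv)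
    rw [h.quad_eq, hw]
    have : Γ.quad (x ∘ f) < 0 := by
      refine hΓ.neg _ (fun h0 => hx ?_) fun v hv => ?_
      · have h1 : ∀ v, x (f v) = 0 := fun v => congrFun h0 v
        ext z
        rcases h.cover z with rfl | ⟨v, rfl⟩
        · rw [h.lin_new] at hw
          simpa [h1] using hw
        · exact h1 v
      · have := hx' (f v) (by rintro ⟨u, hu, huv⟩; exact hv (h.inj huv ▸ hu))
        rw [h.lin_old, hw] at this
        simpa using this
    linarith
  · obtain ⟨l, hl⟩ := hΓ.pos
    refine ⟨l ∘ₗ LinearMap.funLeft ℝ ℝ f, fun x hx => ?_⟩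
    have := hl (x ∘ f) hx
    rw [h.quad_eq]
    linarith [sq_nonneg (Γ'.lin x w)]

theorem down (h : IsBlowUp Γ Γ' f w I) {N : Set (Fin Γ'.n)} {k : ℕ} (hΓ : Γ'.NegDefModulo N k)
    (hlow : ∀ v ∉ f ⁻¹' N, AtMostTwoNeighbors Γ.adj v) :
    Γ.NegDefModulo (f ⁻¹' N) k := by
  obtain ⟨φ, hφ⟩ := h.exists_lift
  have hq : ∀ y, Γ.quad y = Γ'.quad (φ y) := by
    intro y
    rw [h.quad_eq, (hφ y).1, (hφ y).2]
    simp
  refine ⟨hlow, fun x hx hx' => ?_, ?_⟩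
  · rw [hq]
    refine hΓ.neg _ (fun h0 => hx ?_) fun v hv => ?_
    · rw [← (hφ x).1, h0]
      rfl
    · rcases h.cover v with rfl | ⟨v, rfl⟩
      · exact (hφ x).2
      · rw [h.lin_old, (hφ x).2, (hφ x).1, hx' v hv]
        simp
  · obtain ⟨l, hl⟩ := hΓ.pos
    refine ⟨l ∘ₗ φ, fun x hx => ?_⟩
    rw [hq]
    exact hl _ hx

end IsBlowUp

theorem isBlowUp_of_subdivides {Γ Γ' : Plumbing} {f : Fin Γ.n → Fin Γ'.n} {i j : Fin Γ.n}
    {w : Fin Γ'.n} (h : Subdivides Γ.adj Γ'.adj f i j w) (hw : Γ'.weight w = -1)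
    (hf : ∀ v, Γ'.weight (f v) = Γ.weight v + if v = i ∨ v = j then -1 else 0) :
    IsBlowUp Γ Γ' f w {i, j} := by
  have hij := h.adj_ij.ne
  have hnew : ∀ x : Fin Γ'.n → ℝ, Γ'.lin x w = ∑ v ∈ {i, j}, x (f v) - x w := by
    intro x
    rw [lin, h.neighborSum_new, hw, Finset.sum_pair hij]
    push_cast
    ring
  refine ⟨h.inj, h.ne, h.cover, hnew, fun x v => ?_⟩
  rw [hnew, lin, h.neighborSum_old, hf, lin, Finset.sum_pair hij]
  by_cases hi : v = i
  · subst hi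
    simp [hij]
    ring
  · by_cases hj : v = j
    · subst hj
      simp [hij.symm]
      ring
    · simp [hi, hj]

theorem isBlowUp_of_attaches {Γ Γ' : Plumbing} {f : Fin Γ.n → Fin Γ'.n} {i : Fin Γ.n}
    {w : Fin Γ'.n} (h : Attaches Γ.adj Γ'.adj f i w) (hw : Γ'.weight w = -1)
    (hf : ∀ v, Γ'.weight (f v) = Γ.weight v + if v = i then -1 else 0) :
    IsBlowUp Γ Γ' f w {i} := by
  have hnew : ∀ x : Fin Γ'.n → ℝ, Γ'.lin x w = ∑ v ∈ {i}, x (f v) - x w := by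
    intro x
    rw [lin, h.neighborSum_new, hw, Finset.sum_singleton]
    push_cast
    ring
  refine ⟨h.inj, h.ne, h.cover, hnew, fun x v => ?_⟩
  rw [hnew, lin, h.neighborSum_old, hf, lin, Finset.sum_singleton]
  by_cases hi : v = i
  · subst hi
    simp
    ring
  · simp [hi]

end Plumbing

namespace Plumbing

theorem moveA_of_subdivides {Γ Γ' : Plumbing} {f : Fin Γ.n → Fin Γ'.n} {i j : Fin Γ.n}
    {w : Fin Γ'.n} (h : Subdivides Γ.adj Γ'.adj f i j w) (hw : Γ'.weight w = -1)
    (hf : ∀ v, Γ'.weight (f v) = Γ.weight v + if v = i ∨ v = j then -1 else 0) :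
    MoveA (-1) Γ Γ' :=
  ⟨f, i, j, w, h.inj, h.adj_ij, h.ne, h.cover, hw, by simp [hf], by simp [hf],
    fun v hi hj => by simp [hf, hi, hj], h.adj_new, h.adj⟩

theorem moveB_of_attaches {Γ Γ' : Plumbing} {f : Fin Γ.n → Fin Γ'.n} {i : Fin Γ.n}
    {w : Fin Γ'.n} (h : Attaches Γ.adj Γ'.adj f i w) (hw : Γ'.weight w = -1)
    (hf : ∀ v, Γ'.weight (f v) = Γ.weight v + if v = i then -1 else 0) :
    MoveB (-1) Γ Γ' :=
  ⟨f, i, w, h.inj, h.ne, h.cover, hw, by simp [hf],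
    fun v hi => by simp [hf, hi], h.adj_new, h.adj⟩

/-- The edge `s(i, j)` can be blown up. -/
theorem exists_subdivides (Γ : Plumbing) {i j : Fin Γ.n} (hij : Γ.adj.Adj i j) :
    ∃ (Γ' : Plumbing) (f : Fin Γ.n → Fin Γ'.n) (w : Fin Γ'.n),
      Subdivides Γ.adj Γ'.adj f i j w ∧ Γ'.weight w = -1 ∧
      ∀ v, Γ'.weight (f v) = Γ.weight v + if v = i ∨ v = j then -1 else 0 := by
  let G : SimpleGraph (Fin (Γ.n + 1)) := SimpleGraph.fromRel fun x y =>
    (∃ a b, x = a.castSucc ∧ y = b.castSucc ∧ Γ.adj.Adj a b ∧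
      ¬(a = i ∧ b = j) ∧ ¬(a = j ∧ b = i)) ∨
    x = Fin.last _ ∧ (y = i.castSucc ∨ y = j.castSucc)
  have hne : ∀ v : Fin Γ.n, v.castSucc ≠ Fin.last _ := Fin.castSucc_ne_last
  have hG : Subdivides Γ.adj G Fin.castSucc i j (Fin.last _) := by
    refine ⟨Fin.castSucc_injective _, hne, ?_, hij, ?_, ?_⟩
    · intro x
      induction x using Fin.lastCases with
      | last => exact .inl rfl
      | cast v => exact .inr ⟨v, rfl⟩
    · intro v
      simp [G, SimpleGraph.fromRel_adj, hne, (hne _).symm]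
    · intro a b
      simp only [G, SimpleGraph.fromRel_adj, hne, Fin.castSucc_inj, ne_eq, false_and, or_false]
      constructor
      · rintro ⟨-, ⟨p, q, rfl, rfl, h⟩ | ⟨p, q, rfl, rfl, h⟩⟩
        · exact h
        · exact ⟨h.1.symm, fun h' => h.2.2 ⟨h'.2, h'.1⟩, fun h' => h.2.1 ⟨h'.2, h'.1⟩⟩
      · intro h
        exact ⟨h.1.ne, .inl ⟨a, b, rfl, rfl, h⟩⟩
  exact ⟨⟨Γ.n + 1, G, hG.isTree Γ.isTree,
    Fin.lastCases (-1) fun v => Γ.weight v + if v = i ∨ v = j then -1 else 0⟩,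
    Fin.castSucc, Fin.last _, hG, by simp, fun v => by simp⟩

/-- The vertex `i` can be blown up. -/
theorem exists_attaches (Γ : Plumbing) (i : Fin Γ.n) :
    ∃ (Γ' : Plumbing) (f : Fin Γ.n → Fin Γ'.n) (w : Fin Γ'.n),
      Attaches Γ.adj Γ'.adj f i w ∧ Γ'.weight w = -1 ∧
      ∀ v, Γ'.weight (f v) = Γ.weight v + if v = i then -1 else 0 := by
  let G : SimpleGraph (Fin (Γ.n + 1)) := SimpleGraph.fromRel fun x y =>
    (∃ a b, x = a.castSucc ∧ y = b.castSucc ∧ Γ.adj.Adj a b) ∨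
    x = Fin.last _ ∧ y = i.castSucc
  have hne : ∀ v : Fin Γ.n, v.castSucc ≠ Fin.last _ := Fin.castSucc_ne_last
  have hG : Attaches Γ.adj G Fin.castSucc i (Fin.last _) := by
    refine ⟨Fin.castSucc_injective _, hne, ?_, ?_, ?_⟩
    · intro x
      induction x using Fin.lastCases with
      | last => exact .inl rfl
      | cast v => exact .inr ⟨v, rfl⟩
    · intro v
      simp [G, SimpleGraph.fromRel_adj, hne, (hne _).symm]
    · intro a b
      simp only [G, SimpleGraph.fromRel_adj, hne, Fin.castSucc_inj, ne_eq, false_and, or_false]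
      constructor
      · rintro ⟨-, ⟨p, q, rfl, rfl, h⟩ | ⟨p, q, rfl, rfl, h⟩⟩
        · exact h
        · exact h.symm
      · intro h
        exact ⟨h.ne, .inl ⟨a, b, rfl, rfl, h⟩⟩
  exact ⟨⟨Γ.n + 1, G, hG.isTree Γ.isTree,
    Fin.lastCases (-1) fun v => Γ.weight v + if v = i then -1 else 0⟩,
    Fin.castSucc, Fin.last _, hG, by simp, fun v => by simp⟩

/-- An enumeration of the complement of a finite set of vertices. -/
theorem exists_enum {n : ℕ} (S : Set (Fin n)) :
    ∃ (m : ℕ) (f : Fin m → Fin n), Function.Injective f ∧ (∀ v, f v ∉ S) ∧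
      ∀ x ∉ S, ∃ v, f v = x := by
  classical
  let e := (Fintype.equivFin {x : Fin n // x ∉ S}).symm
  refine ⟨_, fun v => (e v).1, Subtype.val_injective.comp e.injective, fun v => (e v).2,
    fun x hx => ⟨e.symm ⟨x, hx⟩, by simp⟩⟩

/-- A vertex of weight `-1` with exactly two neighbors can be blown down. -/
theorem exists_subdivided (Γ' : Plumbing) {w a b : Fin Γ'.n} (hab : a ≠ b)
    (hw : ∀ x, Γ'.adj.Adj w x ↔ (x = a ∨ x = b)) :
    ∃ (Γ : Plumbing) (f : Fin Γ.n → Fin Γ'.n) (i j : Fin Γ.n), Γ.n < Γ'.n ∧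
      Subdivides Γ.adj Γ'.adj f i j w ∧
      ∀ v, Γ'.weight (f v) = Γ.weight v + if v = i ∨ v = j then -1 else 0 := by
  obtain ⟨m, f, hf, hne, hc⟩ := exists_enum {w}
  have hwa : Γ'.adj.Adj w a := (hw a).2 (.inl rfl)
  have hwb : Γ'.adj.Adj w b := (hw b).2 (.inr rfl)
  obtain ⟨i, rfl⟩ := hc a hwa.ne'
  obtain ⟨j, rfl⟩ := hc b hwb.ne'
  have hij : i ≠ j := fun h => hab (h ▸ rfl)
  obtain ⟨S, hS1, -, hS2, hS3⟩ := Γ'.isTree.exists_cut hwa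
  have hnadj : ¬ Γ'.adj.Adj (f i) (f j) := fun h =>
    hS3 _ hwb hab.symm ((hS2 _ _ h (hne i) (hne j)).1 hS1)
  let G : SimpleGraph (Fin m) := SimpleGraph.fromRel fun x y =>
    Γ'.adj.Adj (f x) (f y) ∨ (x = i ∧ y = j)
  have hadj : ∀ x y, G.Adj x y ↔
      Γ'.adj.Adj (f x) (f y) ∨ (x = i ∧ y = j) ∨ (x = j ∧ y = i) := by
    intro x y
    simp only [G, SimpleGraph.fromRel_adj, Γ'.adj.adj_comm (f y) (f x)]
    constructor
    · tauto
    · rintro (h | ⟨rfl, rfl⟩ | ⟨rfl, rfl⟩)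
      · exact ⟨fun h' => h.ne (congrArg f h'), .inl (.inl h)⟩
      · exact ⟨hij, by simp⟩
      · exact ⟨hij.symm, by simp⟩
  have hG : Subdivides G Γ'.adj f i j w := by
    refine ⟨hf, hne, fun x => ?_, (hadj i j).2 (by simp), fun v => ?_, fun x y => ?_⟩
    · by_cases hx : x = w
      exacts [.inl hx, .inr (hc x hx)]
    · rw [hw, hf.eq_iff, hf.eq_iff]
    · rw [hadj]
      constructor
      · intro h
        refine ⟨.inl h, ?_, ?_⟩
        · rintro ⟨rfl, rfl⟩
          exact hnadj h
        · rintro ⟨rfl, rfl⟩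
          exact hnadj h.symm
      · tauto
  refine ⟨⟨m, G, hG.isTree_of_subdivided Γ'.isTree,
    fun v => Γ'.weight (f v) - if v = i ∨ v = j then -1 else 0⟩, f, i, j, ?_, hG, fun v => ?_⟩
  · have := card_eq_of_cover f w hG.inj hG.ne hG.cover
    simp only [Fintype.card_fin] at this
    have h2 : Γ'.n = m + 1 := by exact_mod_cast this
    show m < Γ'.n
    omega
  · simp

/-- A vertex of weight `0` with exactly two neighbors `a` and `u` can be absorbed. -/
theorem exists_split (Γ' : Plumbing) {w a u : Fin Γ'.n} (hau : a ≠ u)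
    (hw : ∀ x, Γ'.adj.Adj w x ↔ (x = a ∨ x = u)) :
    ∃ (Γ : Plumbing) (f : Fin Γ.n → Fin Γ'.n) (c : Fin Γ.n) (P : Fin Γ.n → Prop),
      Splits Γ.adj Γ'.adj f c w u P ∧
      Γ.weight c = Γ'.weight (f c) + Γ'.weight u ∧
      ∀ v, v ≠ c → Γ'.weight (f v) = Γ.weight v := by
  obtain ⟨m, f, hf, hne, hc⟩ := exists_enum {w, u}
  have hwa : Γ'.adj.Adj w a := (hw a).2 (.inl rfl)
  have hwu : Γ'.adj.Adj w u := (hw u).2 (.inr rfl)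
  obtain ⟨c, rfl⟩ := hc a (by simp [hwa.ne', hau])
  have hnw : ∀ v, f v ≠ w := fun v h => hne v (by simp [h])
  have hnu : ∀ v, f v ≠ u := fun v h => hne v (by simp [h])
  obtain ⟨S, hS1, -, hS2, hS3⟩ := Γ'.isTree.exists_cut hwu
  have hcS : f c ∉ S := hS3 _ hwa (hnu c)
  have hnadj : ∀ v, Γ'.adj.Adj u (f v) → ¬ Γ'.adj.Adj (f v) (f c) := fun v h1 h2 =>
    hcS ((hS2 _ _ h2 (hnw v) (hnw c)).1 ((hS2 _ _ h1 hwu.ne' (hnw v)).1 hS1))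
  have hnadj' : ¬ Γ'.adj.Adj u (f c) := fun h => hcS ((hS2 _ _ h hwu.ne' (hnw c)).1 hS1)
  let G : SimpleGraph (Fin m) := SimpleGraph.fromRel fun x y =>
    Γ'.adj.Adj (f x) (f y) ∨ (x = c ∧ Γ'.adj.Adj u (f y))
  have hadj : ∀ x y, G.Adj x y ↔ Γ'.adj.Adj (f x) (f y) ∨
      (x = c ∧ Γ'.adj.Adj u (f y)) ∨ (y = c ∧ Γ'.adj.Adj u (f x)) := by
    intro x y
    simp only [G, SimpleGraph.fromRel_adj, Γ'.adj.adj_comm (f y) (f x)]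
    constructor
    · tauto
    · rintro (h | ⟨rfl, h⟩ | ⟨rfl, h⟩)
      · exact ⟨fun h' => h.ne (congrArg f h'), .inl (.inl h)⟩
      · refine ⟨?_, by simp [h]⟩
        rintro rfl
        exact hnadj' h
      · refine ⟨?_, by simp [h]⟩
        rintro rfl
        exact hnadj' h
  have hG : Splits G Γ'.adj f c w u (fun v => Γ'.adj.Adj (f v) (f c)) := by
    refine ⟨hf, hwu.ne, hnw, hnu, fun x => ?_, hw, fun v => ?_, fun v hv => ?_,
      fun x y hx hy => ?_⟩
    · by_cases hx : x = w
      · exact .inl hx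
      by_cases hx' : x = u
      · exact .inr (.inl hx')
      exact .inr (.inr (hc x (by simp [hx, hx'])))
    · rw [hadj]
      constructor
      · intro h
        refine ⟨?_, by simp [h], hnadj v h⟩
        rintro rfl
        exact hnadj' h
      · tauto
    · rw [hadj]
      tauto
    · rw [hadj]
      tauto
  refine ⟨⟨m, G, hG.isTree_of_split Γ'.isTree,
    fun v => if v = c then Γ'.weight (f c) + Γ'.weight u else Γ'.weight (f v)⟩, f, c, _, hG,
    by simp, fun v hv => by simp [hv]⟩

theorem moveC_of_splits {Γ Γ' : Plumbing} {f : Fin Γ.n → Fin Γ'.n} {c : Fin Γ.n}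
    {w u : Fin Γ'.n} {P : Fin Γ.n → Prop} (h : Splits Γ.adj Γ'.adj f c w u P)
    (hw : Γ'.weight w = 0) (hc : Γ.weight c = Γ'.weight (f c) + Γ'.weight u)
    (hf : ∀ v, v ≠ c → Γ'.weight (f v) = Γ.weight v) : MoveC Γ Γ' :=
  ⟨f, c, w, u, _, _, P, h.inj, h.ne_wu, h.ne_w, h.ne_u, h.cover, hc.symm, rfl, rfl, hw, hf,
    h.adj_w, h.adj_u, h.adj_c, h.adj⟩

section Splits

variable {Γ Γ' : Plumbing} {f : Fin Γ.n → Fin Γ'.n} {c : Fin Γ.n} {w u : Fin Γ'.n}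
  {P : Fin Γ.n → Prop}

/-- The isometric embedding of the form of `Γ` into the form of a plumbing tree obtained by
replacing `c` by a chain with central weight `0`. -/
theorem exists_lift_of_splits (h : Splits Γ.adj Γ'.adj f c w u P)
    (hw : Γ'.weight w = 0) (hc : Γ.weight c = Γ'.weight (f c) + Γ'.weight u)
    (hf : ∀ v, v ≠ c → Γ'.weight (f v) = Γ.weight v) :
    ∃ φ : (Fin Γ.n → ℝ) →ₗ[ℝ] (Fin Γ'.n → ℝ), Function.Injective φ ∧
      (∀ y, Γ'.quad (φ y) = Γ.quad y) ∧ (∀ y, Γ'.lin (φ y) w = 0) ∧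
      (∀ y, Γ'.lin (φ y) u = 0) ∧ ∀ y v, Γ.lin y v = 0 → Γ'.lin (φ y) (f v) = 0 := by
  classical
  have hwu : Γ'.adj.Adj w u := (h.adj_w u).2 (.inr rfl)
  have hwc : Γ'.adj.Adj w (f c) := (h.adj_w _).2 (.inl rfl)
  obtain ⟨S, hS1, -, hS2, hS3⟩ := Γ'.isTree.exists_cut hwu
  have hcS : f c ∉ S := hS3 _ hwc (h.ne_u c)
  have : Nonempty (Fin Γ.n) := ⟨c⟩
  obtain ⟨r, hr⟩ := h.inj.hasLeftInverse
  let τ : Fin Γ'.n → ℝ := fun z => if z ∈ S then -1 else 1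
  have hτ : ∀ z, τ z * τ z = 1 := by
    intro z
    simp only [τ]
    split_ifs <;> norm_num
  have hτc : τ (f c) = 1 := if_neg hcS
  have hτP : ∀ v, Γ.adj.Adj v c → P v → τ (f v) = 1 := by
    intro v hv hP
    have := (h.adj_c v hv.ne).2 ⟨hv, hP⟩
    exact if_neg fun hS => hcS ((hS2 _ _ this (h.ne_w v) (h.ne_w c)).1 hS)
  have hτP' : ∀ v, Γ.adj.Adj v c → ¬ P v → τ (f v) = -1 := by
    intro v hv hP
    have := (h.adj_u v).2 ⟨hv.ne, hv, hP⟩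
    exact if_pos ((hS2 _ _ this h.ne_wu.symm (h.ne_w v)).1 hS1)
  have hτa : ∀ v z, v ≠ c → z ≠ c → Γ.adj.Adj v z → τ (f v) = τ (f z) := by
    intro v z hv hz hvz
    have := hS2 _ _ ((h.adj v z hv hz).2 hvz) (h.ne_w v) (h.ne_w z)
    simp only [τ, this]
  let T : (Fin Γ.n → ℝ) → ℝ := fun y =>
    Γ'.weight u * y c + ∑ v, if Γ.adj.Adj v c ∧ ¬ P v then y v else 0
  let F : (Fin Γ.n → ℝ) → Fin Γ'.n → ℝ := fun y z =>
    if z = w then T y else if z = u then -y c else τ z * y (r z)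
  have Fw : ∀ y, F y w = T y := fun y => if_pos rfl
  have Fu : ∀ y, F y u = -y c := fun y => by simp [F, h.ne_wu.symm]
  have Ff : ∀ y v, F y (f v) = τ (f v) * y v := fun y v => by
    simp [F, h.ne_w, h.ne_u, hr v]
  have Lw : ∀ y, Γ'.lin (F y) w = 0 := by
    intro y
    rw [lin, h.neighborSum_w, hw, Ff, Fu, hτc]
    simp
  have hsum : ∀ y : Fin Γ.n → ℝ, (∑ v, if Γ.adj.Adj v c ∧ ¬ P v then F y (f v) else 0) =
      -∑ v, if Γ.adj.Adj v c ∧ ¬ P v then y v else 0 := by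
    intro y
    rw [← Finset.sum_neg_distrib]
    refine Finset.sum_congr rfl fun v _ => ?_
    split_ifs with hv
    · rw [Ff, hτP' v hv.1 hv.2]
      ring
    · simp
  have Lu : ∀ y, Γ'.lin (F y) u = 0 := by
    intro y
    rw [lin, h.neighborSum_u, hsum, Fu, Fw]
    simp only [T]
    ring
  have Lc : ∀ y, Γ'.lin (F y) (f c) = Γ.lin y c := by
    intro y
    have h1 : (∑ v, if Γ.adj.Adj v c ∧ P v then F y (f v) else 0) =
        ∑ v, if Γ.adj.Adj v c ∧ P v then y v else 0 := by
      refine Finset.sum_congr rfl fun v _ => ?_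
      split_ifs with hv
      · rw [Ff, hτP v hv.1 hv.2]
        ring
      · rfl
    have h2 : neighborSum Γ.adj y c = (∑ v, if Γ.adj.Adj v c ∧ ¬ P v then y v else 0) +
        ∑ v, if Γ.adj.Adj v c ∧ P v then y v else 0 := by
      rw [← Finset.sum_add_distrib, neighborSum]
      refine Finset.sum_congr rfl fun v _ => ?_
      rw [Γ.adj.adj_comm]
      by_cases hP : P v <;> simp [hP]
    rw [lin, h.neighborSum_c, h1, Ff, hτc, Fw, lin, h2, hc]
    simp only [T]
    push_cast
    ring
  have Lf : ∀ y v, v ≠ c → Γ'.lin (F y) (f v) = τ (f v) * Γ.lin y v := by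
    intro y v hv
    rw [lin, h.neighborSum_old _ hv, lin, hf v hv, Ff, mul_add, neighborSum, Finset.mul_sum]
    congr 1
    · ring
    · refine Finset.sum_congr rfl fun z _ => ?_
      split_ifs with h1 h2 h3
      · subst h2
        rw [Ff, hτP v h1 h3, hτc]
      · subst h2
        rw [Fu, hτP' v h1 h3]
        ring
      · rw [Ff, hτa v z hv h2 h1]
      · ring
  have Lall : ∀ y v, Γ'.lin (F y) (f v) = τ (f v) * Γ.lin y v := by
    intro y v
    by_cases hv : v = c
    · subst hv
      rw [Lc, hτc, one_mul]
    · exact Lf y v hv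
  refine ⟨{ toFun := F, map_add' := ?_, map_smul' := ?_ }, ?_, ?_, Lw, Lu, ?_⟩
  · intro x y
    have hT : T (x + y) = T x + T y := by
      simp only [T, Pi.add_apply, mul_add, ite_add_zero, Finset.sum_add_distrib]
      ring
    ext z
    simp only [F, hT, Pi.add_apply]
    split_ifs <;> ring
  · intro a x
    have hT : T (a • x) = a * T x := by
      simp only [T, Pi.smul_apply, smul_eq_mul, mul_add, Finset.mul_sum, mul_ite, mul_zero]
      ring
    ext z
    simp only [F, hT, Pi.smul_apply, smul_eq_mul, RingHom.id_apply]
    split_ifs <;> ring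
  · intro x y hxy
    ext v
    have h1 : F x (f v) = F y (f v) := congrFun hxy (f v)
    rw [Ff, Ff] at h1
    have h2 := congrArg (τ (f v) * ·) h1
    simpa only [← mul_assoc, hτ, one_mul] using h2
  · intro y
    show Γ'.quad (F y) = _
    rw [quad, sum_eq_add_add_sum_of_cover f w u h.inj h.ne_wu h.ne_w h.ne_u h.cover, Lw, Lu, quad,
      mul_zero, mul_zero, zero_add, zero_add]
    refine Finset.sum_congr rfl fun v _ => ?_
    rw [Lall, Ff]
    linear_combination y v * Γ.lin y v * hτ (f v)
  · intro y v hv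
    show Γ'.lin (F y) (f v) = 0
    rw [Lall, hv, mul_zero]

theorem NegDefModulo.of_splits (h : Splits Γ.adj Γ'.adj f c w u P)
    (hw : Γ'.weight w = 0) (hc : Γ.weight c = Γ'.weight (f c) + Γ'.weight u)
    (hf : ∀ v, v ≠ c → Γ'.weight (f v) = Γ.weight v) {N : Set (Fin Γ'.n)} {k : ℕ}
    (hΓ : Γ'.NegDefModulo N k) (huN : u ∉ N) :
    ∃ k' < k, Γ.NegDefModulo (f ⁻¹' N) k' := by
  classical
  obtain ⟨φ, hφi, hφq, hφw, hφu, hφ⟩ := exists_lift_of_splits h hw hc hf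
  obtain ⟨l, hl⟩ := hΓ.pos
  have hwu : Γ'.adj.Adj w u := (h.adj_w u).2 (.inr rfl)
  obtain ⟨p, hpq, hpφ⟩ : ∃ p : Fin Γ'.n → ℝ, 0 < Γ'.quad p ∧
      ∀ y, ∑ v, p v * Γ'.lin (φ y) v = 0 := by
    obtain ⟨b, hb⟩ : ∃ b : ℝ, (Γ'.weight u : ℝ) = b := ⟨_, rfl⟩
    refine ⟨(Pi.single u 1 : Fin Γ'.n → ℝ) + (Pi.single w (1 + b ^ 2) : Fin Γ'.n → ℝ), ?_,
      fun y => ?_⟩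
    · rw [quad_add, quad_single, quad_single, hw, hb, Finset.sum_eq_single w]
      · simp only [lin, neighborSum_single, hwu, if_true]
        simp [h.ne_wu]
        nlinarith [sq_nonneg (b + 1)]
      · intro v _ hv
        simp [hv]
      · simp
    · rw [sum_eq_add_add_sum_of_cover f w u h.inj h.ne_wu h.ne_w h.ne_u h.cover, hφw, hφu]
      simp [h.ne_w, h.ne_u]
  have hlp : l p ≠ 0 := fun h0 => absurd (hl p h0) hpq.not_ge
  obtain ⟨i, hi⟩ := Function.ne_iff.1 hlp
  obtain ⟨k', rfl⟩ : ∃ k', k = k' + 1 := Nat.exists_eq_succ_of_ne_zero (by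
    rintro rfl
    exact i.elim0)
  refine ⟨k', by omega, fun v hv => ?_, fun x hx hx' => ?_, ?_⟩
  · have : Nonempty (Fin Γ.n) := ⟨c⟩
    obtain ⟨r, hr⟩ := h.inj.hasLeftInverse
    let ρ : Fin Γ'.n → Fin Γ.n := fun z => if z = u then c else r z
    have hρ : ∀ x, ρ (f x) = x := fun x => by simp [ρ, h.ne_u, hr x]
    have hρu : ρ u = c := if_pos rfl
    by_cases hvc : v = c
    · subst hvc
      obtain ⟨a, ha⟩ := (hΓ.low _ hv).exists_other ((h.adj_w _).2 (.inl rfl)).symm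
      obtain ⟨b, hb⟩ := (hΓ.low _ huN).exists_other hwu.symm
      refine ⟨ρ a, ρ b, fun x hx => ?_⟩
      by_cases hP : P x
      · rcases ha _ ((h.adj_c x hx.ne').2 ⟨hx.symm, hP⟩).symm with h' | h'
        exacts [absurd h' (h.ne_w x), .inl (by rw [← h', hρ])]
      · rcases hb _ ((h.adj_u x).2 ⟨hx.ne', hx.symm, hP⟩) with h' | h'
        exacts [absurd h' (h.ne_w x), .inr (by rw [← h', hρ])]
    · refine AtMostTwoNeighbors.of_map ρ (hΓ.low _ hv) fun x hx => ?_
      by_cases hxc : x = c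
      · subst hxc
        by_cases hP : P v
        · exact ⟨_, (h.adj_c v hvc).2 ⟨hx, hP⟩, hρ _⟩
        · exact ⟨_, ((h.adj_u v).2 ⟨hvc, hx, hP⟩).symm, hρu⟩
      · exact ⟨_, (h.adj v x hvc hxc).2 hx, hρ _⟩
  · rw [← hφq]
    refine hΓ.neg _ (fun h0 => hx (hφi (h0.trans (map_zero φ).symm))) fun v hv => ?_
    rcases h.cover v with rfl | rfl | ⟨v, rfl⟩
    exacts [hφw x, hφu x, hφ x v (hx' v hv)]
  · let t : (Fin Γ.n → ℝ) →ₗ[ℝ] ℝ := -(l p i)⁻¹ • LinearMap.proj i ∘ₗ l ∘ₗ φ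
    let ψ : (Fin Γ.n → ℝ) →ₗ[ℝ] (Fin Γ'.n → ℝ) := φ + t.smulRight p
    refine ⟨LinearMap.funLeft ℝ ℝ i.succAbove ∘ₗ l ∘ₗ ψ, fun x hx => ?_⟩
    have h0 : l (ψ x) = 0 := by
      ext j
      rcases eq_or_ne j i with rfl | hj
      · simp only [Pi.zero_apply] at hi
        simp [ψ, t]
        field_simp
        ring
      · obtain ⟨j, rfl⟩ := Fin.exists_succAbove_eq hj
        exact congrFun hx j
    have h1 := hl _ h0
    have h2 : ψ x = φ x + t x • p := rfl
    rw [h2, quad_add, quad_smul, hφq] at h1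
    simp only [Pi.smul_apply, smul_eq_mul, mul_assoc, ← Finset.mul_sum, hpφ] at h1
    nlinarith [mul_nonneg (sq_nonneg (t x)) hpq.le]

end Splits

/-- `Γ` can be transformed into a negative definite plumbing tree. -/
def ReachesNegDef (Γ : Plumbing) : Prop :=
  ∃ (N : ℕ) (seq : Fin (N + 1) → Plumbing), seq 0 = Γ ∧
    (∀ k : Fin N, NeumannStep (seq k.castSucc) (seq k.succ)) ∧ (seq (Fin.last N)).IsNegDef

theorem ReachesNegDef.step {Γ Γ' : Plumbing} (h : ReachesNegDef Γ') (hs : NeumannStep Γ Γ') :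
    ReachesNegDef Γ := by
  obtain ⟨N, seq, h0, h1, h2⟩ := h
  refine ⟨N + 1, Fin.cons Γ seq, rfl, fun k => ?_, ?_⟩
  · induction k using Fin.cases with
    | zero => simpa [h0] using hs
    | succ k =>
      have := h1 k
      rwa [← Fin.succ_castSucc, Fin.cons_succ, Fin.cons_succ]
  · rwa [← Fin.succ_last, Fin.cons_succ]

theorem neumannStep_of_moveA {Γ Γ' : Plumbing} (h : MoveA (-1) Γ Γ') : NeumannStep Γ Γ' :=
  .inl ⟨-1, .inr rfl, .inl h⟩

theorem neumannStep_of_moveB {Γ Γ' : Plumbing} (h : MoveB (-1) Γ Γ') : NeumannStep Γ Γ' :=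
  .inl ⟨-1, .inr rfl, .inr (.inr (.inl h))⟩

theorem neumannStep_symm {Γ Γ' : Plumbing} (h : NeumannStep Γ Γ') : NeumannStep Γ' Γ := by
  rcases h with ⟨ε, hε, h⟩ | h
  · exact .inl ⟨ε, hε, by tauto⟩
  · exact .inr h.symm

/-- The plumbing tree `Γ` with the weight of `a` replaced by `m`. -/
def setWeight (Γ : Plumbing) (a : Fin Γ.n) (m : ℤ) : Plumbing :=
  { Γ with weight := Function.update Γ.weight a m }

/-- A leaf of weight `0` allows one to change the weight of its neighbor. -/
theorem reachesNegDef_setWeight_succ_iff (Γ : Plumbing) {a v : Fin Γ.n}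
    (hv : ∀ x, Γ.adj.Adj v x ↔ x = a) (hw : Γ.weight v = 0) (m : ℤ) :
    ReachesNegDef (Γ.setWeight a m) ↔ ReachesNegDef (Γ.setWeight a (m + 1)) := by
  have hva : v ≠ a := ((hv a).2 rfl).ne
  obtain ⟨T, f, w, hT, hTw, hTf⟩ := exists_attaches (Γ.setWeight a m) v
  change Fin Γ.n → Fin T.n at f
  change Attaches Γ.adj T.adj f v w at hT
  have hTf' : ∀ x : Fin Γ.n, T.weight (f x) =
    Function.update Γ.weight a m x + if x = v then -1 else 0 := hTf
  have hB : NeumannStep (Γ.setWeight a m) T :=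
    neumannStep_of_moveB (moveB_of_attaches hT hTw hTf)
  have hsub : Subdivides Γ.adj T.adj (Function.update f v w) a v (f v) := by
    have hupd : ∀ x, x ≠ v → Function.update f v w x = f x := fun x hx => by simp [hx]
    have hupd' : Function.update f v w v = w := by simp
    refine ⟨?_, fun x => ?_, fun x => ?_, ((hv a).2 rfl).symm, fun x => ?_, fun x y => ?_⟩
    · intro x y hxy
      by_cases hx : x = v <;> by_cases hy : y = v
      · rw [hx, hy]
      · rw [hx, hupd', hupd y hy] at hxy
        exact absurd hxy.symm (hT.ne y)
      · rw [hy, hupd', hupd x hx] at hxy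
        exact absurd hxy (hT.ne x)
      · rw [hupd x hx, hupd y hy] at hxy
        exact hT.inj hxy
    · by_cases hx : x = v
      · rw [hx, hupd']
        exact (hT.ne v).symm
      · rw [hupd x hx]
        exact fun h => hx (hT.inj h)
    · rcases hT.cover x with rfl | ⟨y, rfl⟩
      · exact .inr ⟨v, hupd'⟩
      · by_cases hy : y = v
        · exact .inl (by rw [hy])
        · exact .inr ⟨y, hupd y hy⟩
    · by_cases hx : x = v
      · rw [hx, hupd', T.adj.adj_comm, hT.adj_new]
        simp
      · rw [hupd x hx, hT.adj, hv]
        simp [hx]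
    · by_cases hx : x = v <;> by_cases hy : y = v
      · simp [hx, hy]
      · rw [hx, hupd', hupd y hy, hT.adj_new, hv]
        simp [hy, hva]
      · rw [hy, hupd', hupd x hx, T.adj.adj_comm, hT.adj_new, Γ.adj.adj_comm, hv]
        simp [hx]
      · rw [hupd x hx, hupd y hy, hT.adj]
        simp [hx, hy]
  have hA : NeumannStep (Γ.setWeight a (m + 1)) T := by
    have hwt : ∀ x : Fin Γ.n, T.weight (Function.update f v w x) =
        Function.update Γ.weight a (m + 1) x + if x = a ∨ x = v then -1 else 0 := by
      intro x
      by_cases hx : x = v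
      · subst hx
        simp [hva, hw, hTw]
      · simp only [Function.update_of_ne hx, hTf', if_neg hx]
        by_cases hxa : x = a
        · subst hxa
          simp
        · simp [hxa, hx]
    refine neumannStep_of_moveA (moveA_of_subdivides hsub ?_ hwt)
    rw [hTf']
    simp [hva, hw]
  exact ⟨fun h => (h.step (neumannStep_symm hB)).step hA,
    fun h => (h.step (neumannStep_symm hA)).step hB⟩

theorem reachesNegDef_of_setWeight (Γ : Plumbing) {a v : Fin Γ.n}
    (hv : ∀ x, Γ.adj.Adj v x ↔ x = a) (hw : Γ.weight v = 0)
    (h : ReachesNegDef (Γ.setWeight a 0)) : ReachesNegDef Γ := by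
  have key : ∀ m : ℤ, ReachesNegDef (Γ.setWeight a m) := by
    intro m
    induction m using Int.induction_on with
    | zero => exact h
    | succ i ih => exact (Γ.reachesNegDef_setWeight_succ_iff hv hw _).1 ih
    | pred i ih =>
      refine (Γ.reachesNegDef_setWeight_succ_iff hv hw _).2 ?_
      simpa using ih
  have := key (Γ.weight a)
  rwa [setWeight, Function.update_eq_self] at this

theorem NegDefModulo.setWeight {Γ : Plumbing} {N : Set (Fin Γ.n)} {k : ℕ}
    (hΓ : Γ.NegDefModulo N k) {a v : Fin Γ.n} (hv : ∀ x, Γ.adj.Adj v x ↔ x = a)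
    (hvN : v ∉ N) (hw : Γ.weight v = 0) (m : ℤ) :
    (Γ.setWeight a m).NegDefModulo (N : Set (Fin Γ.n)) k := by
  classical
  have hva : v ≠ a := ((hv a).2 rfl).ne
  set Δ := Γ.setWeight a m with hΔ
  have hlin : ∀ (x : Fin Γ.n → ℝ) (u : Fin Γ.n), Δ.lin x u = Γ.lin x u +
      if u = a then (m - Γ.weight a) * x u else 0 := by
    intro x u
    change (Function.update Γ.weight a m u : ℝ) * x u + neighborSum Γ.adj x u = _
    rw [lin]
    by_cases hu : u = a
    · subst hu
      simp
      ring
    · simp [hu]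
  have hlv : ∀ x : Fin Γ.n → ℝ, Γ.lin x v = x a := by
    intro x
    rw [lin, hw, neighborSum]
    simp [hv]
  have hquad : ∀ x : Fin Γ.n → ℝ, Δ.quad x = Γ.quad x + (m - Γ.weight a) * x a ^ 2 := by
    intro x
    change ∑ u : Fin Γ.n, x u * Δ.lin x u = _
    simp only [hlin, mul_add, Finset.sum_add_distrib, mul_ite, mul_zero, Finset.sum_ite_eq',
      Finset.mem_univ, if_true]
    rw [quad]
    ring
  refine ⟨hΓ.low, fun x hx hx' => ?_, ?_⟩
  · change Fin Γ.n → ℝ at x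
    have h0 : x a = 0 := by
      have := hx' v hvN
      rwa [hlin, if_neg hva, add_zero, hlv] at this
    rw [hquad, h0]
    have := hΓ.neg x hx fun u hu => by
      have := hx' u hu
      rw [hlin] at this
      by_cases hua : u = a
      · subst hua
        simpa [h0] using this
      · simpa [hua] using this
    linarith
  · obtain ⟨l, hl⟩ := hΓ.pos
    let φ : (Fin Γ.n → ℝ) →ₗ[ℝ] (Fin Γ.n → ℝ) := LinearMap.id +
      ((((m : ℝ) - Γ.weight a) / 2) • LinearMap.proj a).smulRight (Pi.single v 1)
    refine ⟨l ∘ₗ φ, fun x hx => ?_⟩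
    change Fin Γ.n → ℝ at x
    have h1 : Γ.quad (x + (((m : ℝ) - Γ.weight a) / 2 * x a) • Pi.single v 1) ≤ 0 := hl _ hx
    rw [quad_add, quad_smul, quad_single, hw, Finset.sum_eq_single v] at h1
    · rw [hlv] at h1
      simp at h1
      change Δ.quad x ≤ 0
      rw [hquad]
      linarith
    · intro u _ hu
      simp [hu]
    · simp

end Plumbing

section Low

variable {V V' : Type} {G : SimpleGraph V} {G' : SimpleGraph V'} {f : V → V'} {N : Set V}

theorem Subdivides.atMostTwoNeighbors {i j : V} {w : V'} (h : Subdivides G G' f i j w)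
    (hN : ∀ v ∉ N, AtMostTwoNeighbors G v) : ∀ v ∉ f '' N, AtMostTwoNeighbors G' v := by
  classical
  intro v hv
  rcases h.cover v with rfl | ⟨v, rfl⟩
  · refine ⟨f i, f j, fun x hx => ?_⟩
    rcases h.cover x with rfl | ⟨x, rfl⟩
    · exact absurd hx (G'.irrefl)
    · rcases (h.adj_new x).1 hx with rfl | rfl <;> simp
  · refine (hN v fun hvN => hv ⟨v, hvN, rfl⟩).of_map
      (fun x => if (v = i ∧ x = j) ∨ (v = j ∧ x = i) then w else f x) fun x hx => ?_
    rcases h.cover x with rfl | ⟨x, rfl⟩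
    · rcases (h.adj_new v).1 hx.symm with rfl | rfl
      · exact ⟨j, h.adj_ij, if_pos (by simp)⟩
      · exact ⟨i, h.adj_ij.symm, if_pos (by simp)⟩
    · obtain ⟨hvx, h1, h2⟩ := (h.adj v x).1 hx
      exact ⟨x, hvx, if_neg (by tauto)⟩

theorem Subdivides.atMostTwoNeighbors_preimage {N : Set V'} {i j : V} {w : V'}
    (h : Subdivides G G' f i j w) (hN : ∀ v ∉ N, AtMostTwoNeighbors G' v) :
    ∀ v ∉ f ⁻¹' N, AtMostTwoNeighbors G v := by
  classical
  intro v hv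
  have : Nonempty V := ⟨v⟩
  obtain ⟨r, hr⟩ := h.inj.hasLeftInverse
  refine (hN (f v) hv).of_map (fun z => if z = w then (if v = i then j else i) else r z)
    fun x hx => ?_
  by_cases h1 : v = i ∧ x = j
  · exact ⟨w, ((h.adj_new v).2 (.inl h1.1)).symm, by simp [h1]⟩
  by_cases h2 : v = j ∧ x = i
  · exact ⟨w, ((h.adj_new v).2 (.inr h2.1)).symm, by simp [h2, h.adj_ij.ne']⟩
  exact ⟨f x, (h.adj v x).2 ⟨hx, h1, h2⟩, by simp [h.ne, hr x]⟩

theorem Attaches.atMostTwoNeighbors {i a : V} {w : V'} (h : Attaches G G' f i w)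
    (hi : ∀ x, G.Adj i x → x = a) (hN : ∀ v ∉ N, AtMostTwoNeighbors G v) :
    ∀ v ∉ f '' N, AtMostTwoNeighbors G' v := by
  intro v hv
  rcases h.cover v with rfl | ⟨v, rfl⟩
  · refine ⟨f i, f i, fun x hx => ?_⟩
    rcases h.cover x with rfl | ⟨x, rfl⟩
    · exact absurd hx (G'.irrefl)
    · simp [(h.adj_new x).1 hx]
  · by_cases hvi : v = i
    · subst hvi
      refine ⟨w, f a, fun x hx => ?_⟩
      rcases h.cover x with rfl | ⟨x, rfl⟩
      · exact .inl rfl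
      · exact .inr (congrArg f (hi x ((h.adj v x).1 hx)))
    · refine (hN v fun hvN => hv ⟨v, hvN, rfl⟩).of_map f fun x hx => ?_
      rcases h.cover x with rfl | ⟨x, rfl⟩
      · exact absurd ((h.adj_new v).1 hx.symm) hvi
      · exact ⟨x, (h.adj v x).1 hx, rfl⟩

end Low

namespace Plumbing

section Reach

variable {Γ : Plumbing} {N : Set (Fin Γ.n)} {k : ℕ}

theorem NegDefModulo.exists_adj_notMem (hΓ : Γ.NegDefModulo N k) {v : Fin Γ.n}
    (hw : Γ.weight v = 0) : ∃ u ∉ N, Γ.adj.Adj v u := by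
  classical
  by_contra! h
  have := hΓ.neg (Pi.single v 1) (by simp) fun z hz => ?_
  · rw [quad_single, hw] at this
    simp at this
  · rw [lin, neighborSum_single, if_neg fun h' => h z hz h'.symm]
    by_cases hzv : z = v
    · simp [hzv, hw]
    · simp [hzv]

theorem NegDefModulo.reachesNegDef_of_chain
    (ih : ∀ k' < k, ∀ (Γ : Plumbing) (N : Set (Fin Γ.n)), Γ.NegDefModulo N k' → ReachesNegDef Γ)
    (hΓ : Γ.NegDefModulo N k) {v a b : Fin Γ.n} (hw : Γ.weight v = 0) (hab : a ≠ b)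
    (hv : ∀ x, Γ.adj.Adj v x ↔ (x = a ∨ x = b)) (hb : b ∉ N) : ReachesNegDef Γ := by
  obtain ⟨Δ, f, c, P, hP, hc, hf⟩ := Γ.exists_split hab hv
  obtain ⟨k', hk, hΔ⟩ := NegDefModulo.of_splits hP hw hc hf hΓ hb
  exact (ih k' hk Δ _ hΔ).step (.inr (.inr (moveC_of_splits hP hw hc hf)))

theorem NegDefModulo.reachesNegDef_of_leaf
    (ih : ∀ k' < k, ∀ (Γ : Plumbing) (N : Set (Fin Γ.n)), Γ.NegDefModulo N k' → ReachesNegDef Γ)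
    (hΓ : Γ.NegDefModulo N k) {v a b : Fin Γ.n} (hw : Γ.weight v = 0) (hbv : b ≠ v)
    (hv : ∀ x, Γ.adj.Adj v x ↔ x = a) (ha : ∀ x, Γ.adj.Adj a x ↔ (x = b ∨ x = v))
    (hvN : v ∉ N) : ReachesNegDef Γ := by
  refine Γ.reachesNegDef_of_setWeight hv hw ?_
  exact (hΓ.setWeight hv hvN hw 0).reachesNegDef_of_chain ih (v := a) (a := b) (b := v)
    (Function.update_self ..) hbv ha hvN

theorem NegDefModulo.reachesNegDef_of_weight_eq_zero
    (ih : ∀ k' < k, ∀ (Γ : Plumbing) (N : Set (Fin Γ.n)), Γ.NegDefModulo N k' → ReachesNegDef Γ)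
    (hΓ : Γ.NegDefModulo N k) {v : Fin Γ.n} (hvN : v ∉ N) (hw : Γ.weight v = 0) :
    ReachesNegDef Γ := by
  obtain ⟨u, huN, hu⟩ := hΓ.exists_adj_notMem hw
  rcases (hΓ.low v hvN).cases with h | ⟨a, ha⟩ | ⟨a, b, hab, hv⟩
  · exact absurd hu (h u)
  · obtain rfl := (ha u).1 hu
    rcases (hΓ.low u huN).cases with h | ⟨z, hz⟩ | ⟨b, c, hbc, hv⟩
    · exact absurd hu.symm (h v)
    · obtain rfl := (hz v).1 hu.symm
      obtain ⟨Δ, f, w, hf, hfw, hff⟩ := Γ.exists_attaches u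
      refine ReachesNegDef.step ?_ (neumannStep_of_moveB (moveB_of_attaches hf hfw hff))
      refine ((isBlowUp_of_attaches hf hfw hff).up hΓ
        (hf.atMostTwoNeighbors (fun x => (hz x).1) hΓ.low)).reachesNegDef_of_leaf ih
        (v := f v) (a := f u) (b := w) ?_ (hf.ne v).symm ?_ ?_ ?_
      · simp [hff, hw, hu.ne]
      · intro x
        rcases hf.cover x with rfl | ⟨x, rfl⟩
        · simp [Δ.adj.adj_comm (f v), hf.adj_new, hu.ne, (hf.ne u).symm]
        · rw [hf.adj, ha, hf.inj.eq_iff]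
      · intro x
        rcases hf.cover x with rfl | ⟨x, rfl⟩
        · simp [Δ.adj.adj_comm (f u), hf.adj_new]
        · simp [hf.adj, hz, hf.inj.eq_iff, hf.ne]
      · rwa [hf.inj.mem_set_image]
    · rcases (hv v).1 hu.symm with rfl | rfl
      · exact hΓ.reachesNegDef_of_leaf ih hw hbc.symm ha (fun x => by rw [hv, or_comm]) hvN
      · exact hΓ.reachesNegDef_of_leaf ih hw hbc ha hv hvN
  · rcases (hv u).1 hu with rfl | rfl
    · exact hΓ.reachesNegDef_of_chain ih hw hab.symm (fun x => by rw [hv, or_comm]) huN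
    · exact hΓ.reachesNegDef_of_chain ih hw hab hv huN

theorem NegDefModulo.reachesNegDef_of_weight_eq_natCast
    (ih : ∀ k' < k, ∀ (Γ : Plumbing) (N : Set (Fin Γ.n)), Γ.NegDefModulo N k' → ReachesNegDef Γ)
    (hΓ : Γ.NegDefModulo N k) {v : Fin Γ.n} (hvN : v ∉ N) (e : ℕ) (hw : Γ.weight v = e) :
    ReachesNegDef Γ := by
  induction e generalizing Γ with
  | zero => exact hΓ.reachesNegDef_of_weight_eq_zero ih hvN (by simpa using hw)
  | succ e ihe =>
    push_cast at hw
    by_cases h : ∃ j, Γ.adj.Adj v j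
    · obtain ⟨j, hj⟩ := h
      obtain ⟨Δ, f, w, hf, hfw, hff⟩ := Γ.exists_subdivides hj
      refine ReachesNegDef.step ?_ (neumannStep_of_moveA (moveA_of_subdivides hf hfw hff))
      refine ihe ((isBlowUp_of_subdivides hf hfw hff).up hΓ (hf.atMostTwoNeighbors hΓ.low))
        (v := f v) ?_ ?_
      · rwa [hf.inj.mem_set_image]
      · simp [hff, hw]
    · push Not at h
      obtain ⟨Δ, f, w, hf, hfw, hff⟩ := Γ.exists_attaches v
      refine ReachesNegDef.step ?_ (neumannStep_of_moveB (moveB_of_attaches hf hfw hff))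
      refine ihe ((isBlowUp_of_attaches hf hfw hff).up hΓ
        (hf.atMostTwoNeighbors (a := v) (fun x hx => absurd hx (h x)) hΓ.low)) (v := f v) ?_ ?_
      · rwa [hf.inj.mem_set_image]
      · simp [hff, hw]

end Reach

theorem quad_le (Γ : Plumbing) (x : Fin Γ.n → ℝ) :
    Γ.quad x ≤ ∑ v, (Γ.weight v + neighborSum Γ.adj 1 v) * x v ^ 2 := by
  classical
  have h1 : ∑ v, neighborSum Γ.adj (x ^ 2) v = ∑ v, neighborSum Γ.adj 1 v * x v ^ 2 := by
    simp only [neighborSum, Finset.sum_mul]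
    rw [Finset.sum_comm]
    refine Finset.sum_congr rfl fun v _ => Finset.sum_congr rfl fun u _ => ?_
    rw [Γ.adj.adj_comm]
    split_ifs <;> simp
  have h2 : ∀ v, x v * neighborSum Γ.adj x v ≤
      (neighborSum Γ.adj 1 v * x v ^ 2 + neighborSum Γ.adj (x ^ 2) v) / 2 := by
    intro v
    simp only [neighborSum, Finset.sum_mul, Finset.mul_sum, ← Finset.sum_add_distrib,
      Finset.sum_div]
    refine Finset.sum_le_sum fun u _ => ?_
    split_ifs
    · simp only [Pi.one_apply, Pi.pow_apply]
      nlinarith [sq_nonneg (x v - x u)]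
    · simp
  calc Γ.quad x = ∑ v, (Γ.weight v * x v ^ 2 + x v * neighborSum Γ.adj x v) :=
        Finset.sum_congr rfl fun v _ => by rw [lin]; ring
    _ ≤ ∑ v, (Γ.weight v * x v ^ 2 +
        (neighborSum Γ.adj 1 v * x v ^ 2 + neighborSum Γ.adj (x ^ 2) v) / 2) :=
        Finset.sum_le_sum fun v _ => by linarith [h2 v]
    _ = _ := by
        simp only [add_mul, Finset.sum_add_distrib, ← Finset.sum_div, h1]
        ring

theorem NegDefModulo.quad_neg {Γ : Plumbing} {N : Set (Fin Γ.n)} {k : ℕ}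
    (hΓ : Γ.NegDefModulo N k) (hw : ∀ v ∉ N, Γ.weight v + neighborSum Γ.adj 1 v ≤ 0)
    {x : Fin Γ.n → ℝ} (hx : x ≠ 0) : Γ.quad x < 0 := by
  classical
  have hoff : ∀ z : Fin Γ.n → ℝ, (∀ v ∈ N, z v = 0) → Γ.quad z ≤ 0 := by
    refine fun z hz => (Γ.quad_le z).trans (Finset.sum_nonpos fun v _ => ?_)
    by_cases hv : v ∈ N
    · simp [hz v hv]
    · exact mul_nonpos_of_nonpos_of_nonneg (hw v hv) (sq_nonneg _)
  have hneg : ∀ y : Fin Γ.n → ℝ, (∀ v ∉ N, Γ.lin y v = 0) → Γ.quad y ≤ 0 := by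
    intro y hy
    rcases eq_or_ne y 0 with rfl | h
    · simp [quad]
    · exact (hΓ.neg y h hy).le
  let T : (Fin Γ.n → ℝ) →ₗ[ℝ] (Fin Γ.n → ℝ) :=
    { toFun := fun z v => if v ∈ N then z v else Γ.lin z v
      map_add' := fun y z => by
        ext v
        simp only [lin_add, Pi.add_apply]
        split_ifs <;> rfl
      map_smul' := fun c z => by
        ext v
        simp only [lin_smul, Pi.smul_apply, smul_eq_mul, RingHom.id_apply]
        split_ifs <;> rfl }
  have hT : ∀ z v, T z v = if v ∈ N then z v else Γ.lin z v := fun _ _ => rfl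
  have hTi : Function.Injective T := by
    refine (injective_iff_map_eq_zero T).2 fun z hz => ?_
    by_contra h
    have h1 : ∀ v, (if v ∈ N then z v else Γ.lin z v) = 0 := fun v => congrFun hz v
    refine (hΓ.neg z h fun v hv => by simpa [hv] using h1 v).ne ?_
    refine Finset.sum_eq_zero fun v _ => ?_
    have := h1 v
    split_ifs at this <;> simp [this]
  have hle : ∀ x, Γ.quad x ≤ 0 := by
    intro x
    obtain ⟨z, hz⟩ := LinearMap.injective_iff_surjective.1 hTi
      (fun v => if v ∈ N then 0 else Γ.lin x v)
    have h1 : ∀ v, (if v ∈ N then z v else Γ.lin z v) = if v ∈ N then 0 else Γ.lin x v :=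
      fun v => congrFun hz v
    have h2 : ∀ v ∈ N, z v = 0 := fun v hv => by simpa [hv] using h1 v
    have h3 : ∀ v ∉ N, Γ.lin (x - z) v = 0 := by
      intro v hv
      have h4 := Γ.lin_add (x - z) z v
      have h5 : Γ.lin z v = Γ.lin x v := by simpa [hv] using h1 v
      rw [sub_add_cancel] at h4
      linarith
    have h4 := Γ.quad_add (x - z) z
    rw [sub_add_cancel, Finset.sum_eq_zero, mul_zero, add_zero] at h4
    · linarith [hneg _ h3, hoff z h2]
    · intro v _
      by_cases hv : v ∈ N
      · rw [h2 v hv, zero_mul]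
      · rw [h3 v hv, mul_zero]
  refine (hle x).lt_of_ne fun h0 => ?_
  refine (hΓ.neg x hx fun v _ => ?_).ne h0
  have h1 : ∀ t : ℝ, 0 ≤ (-Γ.weight v) * (t * t) + (-2 * Γ.lin x v) * t + 0 := by
    intro t
    have h2 := hle (x + Pi.single v t)
    rw [quad_add, quad_single, h0, Finset.sum_eq_single v (by simp +contextual) (by simp)] at h2
    simp only [Pi.single_eq_same] at h2
    linarith
  have h2 := discrim_le_zero h1
  rw [discrim] at h2
  nlinarith [sq_nonneg (Γ.lin x v)]

end Plumbing

theorem isNegDefQ_iff {V : Type} [Fintype V] [DecidableEq V] {A : Matrix V V ℚ} (hA : A.IsSymm) :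
    IsNegDefQ A ↔ ∀ x : V → ℝ, x ≠ 0 → x ⬝ᵥ A.map (↑) *ᵥ x < 0 := by
  have hH : (A.map ((↑) : ℚ → ℝ)).IsHermitian := by
    ext i j
    simp [hA.apply i j]
  have h1 : IsNegDefQ A ↔ (-A.map ((↑) : ℚ → ℝ)).PosDef := by
    have h2 : ∀ i, eigsR A i = hH.eigenvalues i := fun i => by rw [eigsR, dif_pos hH]
    have h3 : Set.range hH.neg.eigenvalues = -Set.range hH.eigenvalues := by
      rw [← hH.spectrum_real_eq_range_eigenvalues, ← hH.neg.spectrum_real_eq_range_eigenvalues,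
        spectrum.neg_eq]
    rw [hH.neg.posDef_iff_eigenvalues_pos, ← Set.forall_mem_range (p := fun μ => 0 < μ), h3]
    simp only [IsNegDefQ, h2, Set.mem_neg, Set.mem_range]
    refine ⟨fun h μ ⟨i, hi⟩ => by linarith [h i], fun h i => ?_⟩
    linarith [h (-hH.eigenvalues i) ⟨i, by rw [neg_neg]⟩]
  rw [h1, Matrix.posDef_iff_dotProduct_mulVec, and_iff_right hH.neg]
  simp [Matrix.neg_mulVec]

namespace Plumbing

theorem framingQ_isSymm (Γ : Plumbing) : (framingQ Γ).IsSymm := by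
  ext i j
  by_cases h : i = j
  · simp [h]
  · simp only [Matrix.transpose_apply, framingQ, Matrix.of_apply, h, Ne.symm h, if_false]
    classical exact if_congr (Γ.adj.adj_comm j i) rfl rfl

theorem framingQ_mulVec (Γ : Plumbing) (x : Fin Γ.n → ℝ) :
    (framingQ Γ).map (↑) *ᵥ x = Γ.lin x := by
  classical
  ext v
  have : ∀ u, (framingQ Γ v u : ℝ) * x u = (if v = u then Γ.weight v * x u else 0) +
      if Γ.adj.Adj v u then x u else 0 := by
    intro u
    by_cases h : v = u
    · subst h
      simp [framingQ]
    · by_cases h' : Γ.adj.Adj v u <;> simp [framingQ, h, h']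
  simp only [Matrix.mulVec, dotProduct, Matrix.map_apply, this, Finset.sum_add_distrib,
    Finset.sum_ite_eq, Finset.mem_univ, if_true]
  rfl

theorem isNegDef_of_quad_neg {Γ : Plumbing} (h : ∀ x ≠ 0, Γ.quad x < 0) : Γ.IsNegDef := by
  refine (isNegDefQ_iff Γ.framingQ_isSymm).2 fun x hx => ?_
  rw [framingQ_mulVec]
  exact h x hx

theorem IsWeaklyNegDef.negDefModulo {Γ : Plumbing} (hΓ : Γ.IsWeaklyNegDef) :
    Γ.NegDefModulo {v | 3 ≤ Nat.card (Γ.adj.neighborSet v)} Γ.n := by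
  classical
  obtain ⟨hu, hn⟩ := hΓ
  refine ⟨fun v hv => ?_, fun x hx hx' => ?_, ⟨LinearMap.id, fun x hx => ?_⟩⟩
  · have hv' : (Γ.adj.neighborSet v).ncard ≤ 2 := Nat.lt_succ_iff.1 (not_le.1 hv)
    by_contra h
    have h1 : ∀ a b, ∃ x, Γ.adj.Adj v x ∧ x ≠ a ∧ x ≠ b := by
      simpa [AtMostTwoNeighbors] using h
    obtain ⟨a, ha, -⟩ := h1 v v
    obtain ⟨b, hb, hba, -⟩ := h1 a a
    obtain ⟨c, hc, hca, hcb⟩ := h1 a b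
    have h2 : ({a, b, c} : Set (Fin Γ.n)) ⊆ Γ.adj.neighborSet v := by
      rintro z (rfl | rfl | rfl) <;> assumption
    have h3 := Set.ncard_le_ncard h2
    rw [Set.ncard_eq_three.2 ⟨a, b, c, hba.symm, hca.symm, hcb.symm, rfl⟩] at h3
    omega
  · set y := Γ.lin x with hy
    have hxy : (framingQ Γ)⁻¹.map (↑) *ᵥ y = x := by
      have h1 : ((framingQ Γ)⁻¹.map ((↑) : ℚ → ℝ)) * (framingQ Γ).map (↑) = 1 := by
        have := congrArg (fun M : Matrix _ _ ℚ => M.map (Rat.castHom ℝ))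
          (Matrix.nonsing_inv_mul _ hu)
        rw [Matrix.map_mul] at this
        simpa using this
      rw [hy, ← framingQ_mulVec, Matrix.mulVec_mulVec, h1, Matrix.one_mulVec]
    have hsub : ∀ g : Fin Γ.n → ℝ, (∀ v, ¬ 3 ≤ Nat.card (Γ.adj.neighborSet v) → g v = 0) →
        ∑ v : {v // 3 ≤ Nat.card (Γ.adj.neighborSet v)}, g v = ∑ v, g v := by
      intro g hg
      rw [← Finset.sum_subtype (Finset.univ.filter fun v => 3 ≤ Nat.card (Γ.adj.neighborSet v))
        (by simp) g]
      refine Finset.sum_subset (Finset.subset_univ _) fun v _ hv => hg v (by simpa using hv)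
    have hsymm : ((framingQ Γ)⁻¹).IsSymm := by
      rw [Matrix.IsSymm, Matrix.transpose_nonsing_inv, Γ.framingQ_isSymm]
    have h1 := (isNegDefQ_iff (hsymm.submatrix _)).1 hn (fun v => y v) fun h0 => hx ?_
    · convert h1
      have h2 : ∀ v, ∑ u : {v // 3 ≤ Nat.card (Γ.adj.neighborSet v)},
          ((framingQ Γ)⁻¹ v u : ℝ) * y u = x v := by
        intro v
        rw [hsub (fun u => ((framingQ Γ)⁻¹ v u : ℝ) * y u) fun u hu => by
          simp only [hx' u hu, mul_zero]]
        exact congrFun hxy v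
      simp only [dotProduct, Matrix.mulVec, Matrix.map_apply, Matrix.submatrix_apply, h2]
      rw [hsub (fun v => y v * x v) fun v hv => by simp only [hx' v hv, zero_mul]]
      exact Finset.sum_congr rfl fun v _ => mul_comm _ _
    · rw [← hxy]
      have : y = 0 := by
        ext v
        by_cases hv : 3 ≤ Nat.card (Γ.adj.neighborSet v)
        · exact congrFun h0 ⟨v, hv⟩
        · exact hx' v hv
      rw [this, Matrix.mulVec_zero]
  · obtain rfl : x = 0 := hx
    simp [quad]

theorem NegDefModulo.reachesNegDef {Γ : Plumbing} {N : Set (Fin Γ.n)} {k : ℕ}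
    (hΓ : Γ.NegDefModulo N k) : ReachesNegDef Γ := by
  classical
  induction k using Nat.strong_induction_on generalizing Γ with
  | _ k ihk =>
  obtain ⟨n, hn⟩ : ∃ n, Γ.n = n := ⟨_, rfl⟩
  induction n using Nat.strong_induction_on generalizing Γ with
  | _ n ihn =>
  have ih : ∀ k' < k, ∀ (Γ : Plumbing) (N : Set (Fin Γ.n)), Γ.NegDefModulo N k' →
      ReachesNegDef Γ := fun k' hk Γ N h => ihk k' hk h
  by_cases hw : ∀ v ∉ N, (Γ.weight v : ℝ) + neighborSum Γ.adj 1 v ≤ 0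
  · exact ⟨0, fun _ => Γ, rfl, fun k => k.elim0,
      isNegDef_of_quad_neg fun x hx => hΓ.quad_neg hw hx⟩
  push Not at hw
  obtain ⟨v, hvN, hv⟩ := hw
  have hnat : 0 ≤ Γ.weight v → ReachesNegDef Γ := fun h =>
    hΓ.reachesNegDef_of_weight_eq_natCast ih hvN (Γ.weight v).toNat (Int.toNat_of_nonneg h).symm
  rcases (hΓ.low v hvN).cases with h | ⟨a, ha⟩ | ⟨a, b, hab, h⟩
  · refine hnat ?_
    have : (0 : ℝ) < Γ.weight v := by simpa [neighborSum, h] using hv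
    exact_mod_cast this.le
  · refine hnat ?_
    have : (0 : ℝ) < Γ.weight v + 1 := by simpa [neighborSum, ha] using hv
    have : 0 < Γ.weight v + 1 := by exact_mod_cast this
    omega
  · have h2 : neighborSum Γ.adj 1 v = 2 := by
      have : (Finset.univ.filter fun x => Γ.adj.Adj v x) = {a, b} := by
        ext x
        simp [h]
      simp [neighborSum, this, Finset.card_pair hab]
    rw [h2] at hv
    have hv' : 0 < Γ.weight v + 2 := by exact_mod_cast hv
    rcases (by omega : 0 ≤ Γ.weight v ∨ Γ.weight v = -1) with h0 | h0
    · exact hnat h0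
    obtain ⟨Δ, f, i, j, hΔ, hf, hff⟩ := Γ.exists_subdivided hab h
    refine ReachesNegDef.step ?_
      (neumannStep_symm (neumannStep_of_moveA (moveA_of_subdivides hf h0 hff)))
    exact ihn Δ.n (hn ▸ hΔ) ((isBlowUp_of_subdivides hf h0 hff).down hΓ
      (hf.atMostTwoNeighbors_preimage hΓ.low)) rfl

end Plumbing

/-- **Main Theorem.**  Every weakly negative definite plumbing tree can be
transformed into a negative definite one by a finite sequence of Neumann
moves (and their inverses). -/
theorem weaklyNegDef_to_negDef (Γ : Plumbing) (hΓ : Γ.IsWeaklyNegDef) :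
    ∃ (N : ℕ) (seq : Fin (N + 1) → Plumbing),
      seq 0 = Γ ∧
      (∀ k : Fin N, NeumannStep (seq k.castSucc) (seq k.succ)) ∧
      (seq (Fin.last N)).IsNegDef := by
  exact hΓ.negDefModulo.reachesNegDef
end
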